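/- There exists a constant C > 0 such that for every integer H ≥ 3, |#M_3(H) − 14H²| ≤ C·H·(log H)·(log log H), where #M_3(H) is the number of generalized degenerate monic integer polynomials of degree 3 and height at most H. -/

import Mathlib

open Polynomial MeasureTheory

/-- A finite set of (nonzero) complex numbers is multiplicatively dependent:
there are integer exponents, not all zero, whose corresponding power product is 1. -/
def MulDep (S : Finset ℂ) : Prop :=
  ∃ k : ℂ → ℤ, (∃ z ∈ S, k z ≠ 0) ∧ ∏ z ∈ S, z ^ k z = 1

/-- The distinct nonzero complex roots of an integer polynomial. -/
noncomputable def nzRoots (f : Polynomial ℤ) : Finset ℂ :=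
  ((f.map (Int.castRingHom ℂ)).roots.toFinset).filter (fun z => z ≠ 0)

/-- A polynomial of degree at least 2 is generalized degenerate if its distinct
nonzero complex roots are multiplicatively dependent. -/
def GenDeg (f : Polynomial ℤ) : Prop :=
  2 ≤ f.natDegree ∧ MulDep (nzRoots f)

/-- Height (max absolute value of coefficients) at most `H`. -/
def HeightLe (f : Polynomial ℤ) (H : ℤ) : Prop :=
  ∀ i, |f.coeff i| ≤ H

def Iset (n : ℕ) (H : ℤ) : Set (Polynomial ℤ) :=
  {f | f.Monic ∧ f.natDegree = n ∧ HeightLe f H ∧ Irreducible f ∧ GenDeg f}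

def Rset (n : ℕ) (H : ℤ) : Set (Polynomial ℤ) :=
  {f | f.Monic ∧ f.natDegree = n ∧ HeightLe f H ∧ ¬ Irreducible f ∧ GenDeg f}

def Mset (n : ℕ) (H : ℤ) : Set (Polynomial ℤ) :=
  {f | f.Monic ∧ f.natDegree = n ∧ HeightLe f H ∧ GenDeg f}

def IstarSet (n : ℕ) (H : ℤ) : Set (Polynomial ℤ) :=
  {f | f.natDegree = n ∧ HeightLe f H ∧ Irreducible f ∧ GenDeg f}

def RstarSet (n : ℕ) (H : ℤ) : Set (Polynomial ℤ) :=
  {f | f.natDegree = n ∧ HeightLe f H ∧ ¬ Irreducible f ∧ GenDeg f}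

def MstarSet (n : ℕ) (H : ℤ) : Set (Polynomial ℤ) :=
  {f | f.natDegree = n ∧ HeightLe f H ∧ GenDeg f}

/-- `nu n` is the (n-1)-dimensional Lebesgue volume of the convex body
`|x_i| ≤ 1 (1 ≤ i ≤ n-1)`, `|x_1 + ⋯ + x_{n-1}| ≤ 1`. -/
noncomputable def nu (n : ℕ) : ℝ :=
  (volume {x : Fin (n - 1) → ℝ | (∀ i, |x i| ≤ 1) ∧ |∑ i, x i| ≤ 1}).toReal

/-- The monic cubic `X ^ 3 + a X ^ 2 + b X + c`. -/
noncomputable def monicCubic (a b c : ℤ) : ℤ[X] := X ^ 3 + C a * X ^ 2 + C b * X + C c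

lemma monicCubic_coeff_two (a b c : ℤ) : (monicCubic a b c).coeff 2 = a := by
  simp [monicCubic, -eq_intCast]

lemma monicCubic_coeff_one (a b c : ℤ) : (monicCubic a b c).coeff 1 = b := by
  simp [monicCubic, coeff_C, -eq_intCast]

lemma monicCubic_coeff_zero (a b c : ℤ) : (monicCubic a b c).coeff 0 = c := by
  simp [monicCubic]

lemma monicCubic_natDegree (a b c : ℤ) : (monicCubic a b c).natDegree = 3 := by
  unfold monicCubic; compute_degree!

lemma monicCubic_monic (a b c : ℤ) : (monicCubic a b c).Monic := by
  unfold monicCubic; monicity!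

lemma eq_monicCubic {f : ℤ[X]} (hf : f.Monic) (hd : f.natDegree = 3) :
    f = monicCubic (f.coeff 2) (f.coeff 1) (f.coeff 0) := by
  have h3 : f.coeff 3 = 1 := by rw [← hd]; exact hf
  conv_lhs => rw [f.as_sum_range, hd]
  simp only [Finset.sum_range_succ, Finset.sum_range_zero, h3, ← C_mul_X_pow_eq_monomial,
    monicCubic]
  simp
  ring

lemma heightLe_monicCubic_iff {a b c H : ℤ} (hH : 1 ≤ H) :
    HeightLe (monicCubic a b c) H ↔ |a| ≤ H ∧ |b| ≤ H ∧ |c| ≤ H := by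
  constructor
  · intro h
    have h2 := h 2
    have h1 := h 1
    have h0 := h 0
    rw [monicCubic_coeff_two] at h2
    rw [monicCubic_coeff_one] at h1
    rw [monicCubic_coeff_zero] at h0
    exact ⟨h2, h1, h0⟩
  · rintro ⟨ha, hb, hc⟩ i
    match i with
    | 0 => rwa [monicCubic_coeff_zero]
    | 1 => rwa [monicCubic_coeff_one]
    | 2 => rwa [monicCubic_coeff_two]
    | 3 =>
      have h := monicCubic_monic a b c
      rw [Monic, leadingCoeff, monicCubic_natDegree] at h
      rw [h]
      simpa using hH
    | i + 4 =>
      rw [coeff_eq_zero_of_natDegree_lt (by rw [monicCubic_natDegree]; omega)]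
      simp only [abs_zero]
      omega

lemma mem_nzRoots_monicCubic {a b c : ℤ} {z : ℂ} :
    z ∈ nzRoots (monicCubic a b c) ↔ z ^ 3 + a * z ^ 2 + b * z + c = 0 ∧ z ≠ 0 := by
  have h0 : (monicCubic a b c).map (Int.castRingHom ℂ) ≠ 0 :=
    ((monicCubic_monic a b c).map _).ne_zero
  rw [nzRoots, Finset.mem_filter, Multiset.mem_toFinset, mem_roots h0, IsRoot.def]
  simp [monicCubic]

lemma genDeg_monicCubic_iff {a b c : ℤ} :
    GenDeg (monicCubic a b c) ↔ MulDep (nzRoots (monicCubic a b c)) := by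
  simp [GenDeg, monicCubic_natDegree]

lemma mulDep_of_mem_of_sq_eq_one {S : Finset ℂ} {z : ℂ} (hz : z ∈ S) (h : z ^ 2 = 1) :
    MulDep S := by
  classical
  refine ⟨fun w => if w = z then 2 else 0, ⟨z, hz, by simp⟩, ?_⟩
  refine Finset.prod_eq_one fun w _ => ?_
  by_cases hw : w = z
  · subst hw
    simp only [if_true]
    exact_mod_cast h
  · simp [hw]

lemma genDeg_of_root_one {a b c : ℤ} (h : 1 + a + b + c = 0) : GenDeg (monicCubic a b c) := by
  rw [genDeg_monicCubic_iff]
  refine mulDep_of_mem_of_sq_eq_one (z := 1) ?_ (by norm_num)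
  rw [mem_nzRoots_monicCubic]
  refine ⟨?_, one_ne_zero⟩
  simpa using mod_cast h

lemma genDeg_of_root_neg_one {a b c : ℤ} (h : -1 + a - b + c = 0) :
    GenDeg (monicCubic a b c) := by
  rw [genDeg_monicCubic_iff]
  refine mulDep_of_mem_of_sq_eq_one (z := -1) ?_ (by norm_num)
  rw [mem_nzRoots_monicCubic]
  refine ⟨?_, by norm_num⟩
  have h' : (-1 + a - b + c : ℂ) = 0 := by exact_mod_cast h
  linear_combination h'

lemma genDeg_of_const_sq_eq_one {a b c : ℤ} (hc : c ^ 2 = 1) : GenDeg (monicCubic a b c) := by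
  classical
  rw [genDeg_monicCubic_iff]
  set g := (monicCubic a b c).map (Int.castRingHom ℂ) with hg
  have hmon : g.Monic := (monicCubic_monic a b c).map _
  have hdeg : g.natDegree = 3 := by
    rw [hg, (monicCubic_monic a b c).natDegree_map, monicCubic_natDegree]
  have hc0 : c ≠ 0 := by rintro rfl; norm_num at hc
  have hprod := (IsAlgClosed.splits g).coeff_zero_eq_prod_roots_of_monic hmon
  have hcoeff : g.coeff 0 = c := by simp [hg, coeff_map, monicCubic_coeff_zero]
  rw [hcoeff, hdeg] at hprod
  have hroots : nzRoots (monicCubic a b c) = g.roots.toFinset := by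
    rw [nzRoots, Finset.filter_eq_self]
    rintro z hz rfl
    rw [Multiset.mem_toFinset, mem_roots hmon.ne_zero, IsRoot.def, ← coeff_zero_eq_eval_zero,
      hcoeff] at hz
    exact hc0 (by exact_mod_cast hz)
  rw [hroots]
  have hcard : g.roots.card = 3 := by rw [← hdeg, (IsAlgClosed.splits g).natDegree_eq_card_roots]
  obtain ⟨z, hz⟩ := Multiset.card_pos_iff_exists_mem.1 (by omega : 0 < g.roots.card)
  refine ⟨fun w => 2 * (g.roots.count w : ℤ), ⟨z, Multiset.mem_toFinset.2 hz, ?_⟩, ?_⟩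
  · have := Multiset.count_pos.2 hz
    simp only [ne_eq, mul_eq_zero, not_or]
    omega
  · have h1 : ∏ w ∈ g.roots.toFinset, w ^ (2 * (g.roots.count w : ℤ)) = g.roots.prod ^ 2 := by
      rw [Finset.prod_multiset_count, ← Finset.prod_pow]
      refine Finset.prod_congr rfl fun w _ => ?_
      rw [← pow_mul, mul_comm, ← zpow_natCast]
      push_cast
      ring_nf
    rw [h1]
    have h2 : (c : ℂ) ^ 2 = 1 := by exact_mod_cast hc
    rw [hprod] at h2
    linear_combination h2

/-- The complex roots of an irreducible rational cubic can be listed so that every multiplicative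
relation between them stays true after a cyclic shift. -/
lemma exists_cyclic_roots {f : ℚ[X]} (hf : Irreducible f) (hd : f.natDegree = 3) :
    ∃ x y z : ℂ, x ≠ y ∧ y ≠ z ∧ x ≠ z ∧ aeval x f = 0 ∧ aeval y f = 0 ∧ aeval z f = 0 ∧
      ∀ i j k : ℤ, x ^ i * y ^ j * z ^ k = 1 → y ^ i * z ^ j * x ^ k = 1 := by
  have : Fact (Nat.Prime 3) := ⟨Nat.prime_three⟩
  have hdvd := Gal.prime_degree_dvd_card hf (hd ▸ Nat.prime_three)
  rw [hd] at hdvd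
  obtain ⟨σ, hσ⟩ := exists_prime_orderOf_dvd_card' (G := f.Gal) 3 hdvd
  have hσ3 : ∀ w : f.SplittingField, σ (σ (σ w)) = w := by
    intro w
    have h : σ ^ 3 = 1 := by rw [← hσ]; exact pow_orderOf_eq_one σ
    have h2 := congrArg (fun τ : f.Gal => τ w) h
    simpa [pow_succ] using! h2
  have hne : σ ≠ 1 := by
    rintro rfl
    simp at hσ
  obtain ⟨w, hw, hmove⟩ : ∃ w ∈ f.rootSet f.SplittingField, σ w ≠ w := by
    by_contra! h
    exact hne (Gal.ext _ fun w hw => h w hw)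
  have hw0 : aeval w f = 0 := (mem_rootSet.1 hw).2
  have hroot : ∀ v : f.SplittingField, aeval v f = 0 → aeval (σ v) f = 0 := by
    intro v hv
    have h := aeval_algHom_apply (σ : f.SplittingField ≃ₐ[ℚ] f.SplittingField) v f
    rw [hv, map_zero] at h
    exact h
  let ι : f.SplittingField →ₐ[ℚ] ℂ :=
    SplittingField.lift f (IsAlgClosed.splits (f.map (algebraMap ℚ ℂ)))
  have hι : Function.Injective ι := ι.injective
  have hrootι : ∀ v : f.SplittingField, aeval v f = 0 → aeval (ι v) f = 0 := by
    intro v hv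
    rw [aeval_algHom_apply, hv, map_zero]
  have hmove2 : σ (σ w) ≠ w := fun h => hmove (by
    have h2 := hσ3 w
    rwa [h] at h2)
  refine ⟨ι w, ι (σ w), ι (σ (σ w)), fun h => hmove (hι h).symm, fun h => hmove ?_,
    fun h => hmove2 (hι h).symm, hrootι _ hw0, hrootι _ (hroot _ hw0),
    hrootι _ (hroot _ (hroot _ hw0)), fun i j k h => ?_⟩
  · exact (σ.injective (hι h)).symm
  · have h1 : w ^ i * σ w ^ j * σ (σ w) ^ k = 1 :=
      hι (by simpa only [map_mul, map_zpow₀, map_one] using h)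
    have h2 := congrArg σ h1
    simp only [map_mul, map_zpow₀, map_one, hσ3] at h2
    have h3 := congrArg ι h2
    simpa only [map_mul, map_zpow₀, map_one] using h3

/-- An integral cubic without integer roots is irreducible over the rationals. -/
lemma irreducible_map_monicCubic {a b c : ℤ} (h : ∀ m : ℤ, m ^ 3 + a * m ^ 2 + b * m + c ≠ 0) :
    Irreducible ((monicCubic a b c).map (algebraMap ℤ ℚ)) := by
  have hm := monicCubic_monic a b c
  rw [← hm.irreducible_iff_irreducible_map_fraction_map,
    hm.irreducible_iff_roots_eq_zero_of_degree_le_three (by rw [monicCubic_natDegree]; norm_num)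
      (by rw [monicCubic_natDegree])]
  refine Multiset.eq_zero_of_forall_notMem fun m hmem => h m ?_
  rw [mem_roots hm.ne_zero, IsRoot.def] at hmem
  simpa [monicCubic] using hmem

/-- Three numbers satisfying a multiplicative relation of nonzero exponents summing to zero,
together with its cyclic shift, have equal norms. -/
lemma norm_eq_of_cyclic_relations {x y z : ℂ} (hx : x ≠ 0) (hy : y ≠ 0) (hz : z ≠ 0)
    {i j k : ℤ} (hne : ¬(i = 0 ∧ j = 0 ∧ k = 0)) (hsum : i + j + k = 0)
    (h1 : x ^ i * y ^ j * z ^ k = 1) (h2 : y ^ i * z ^ j * x ^ k = 1) :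
    ‖x‖ = ‖z‖ ∧ ‖y‖ = ‖z‖ := by
  have key : ∀ {u v w : ℂ}, u ≠ 0 → v ≠ 0 → w ≠ 0 → ∀ p q r : ℤ, u ^ p * v ^ q * w ^ r = 1 →
      p * Real.log ‖u‖ + q * Real.log ‖v‖ + r * Real.log ‖w‖ = 0 := by
    intro u v w hu hv hw p q r h
    have hn := congrArg (fun t : ℂ => Real.log ‖t‖) h
    simp only [norm_mul, norm_zpow, norm_one, Real.log_one] at hn
    rwa [Real.log_mul (by positivity) (by positivity), Real.log_mul (by positivity) (by positivity),
      Real.log_zpow, Real.log_zpow, Real.log_zpow] at hn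
  have e1 := key hx hy hz i j k h1
  have e2 := key hy hz hx i j k h2
  have hk : (k : ℝ) = -i - j := by
    have : k = -i - j := by omega
    rw [this]; push_cast; ring
  rw [hk] at e1 e2
  have hdet : (i : ℝ) ^ 2 + i * j + j ^ 2 ≠ 0 := by
    intro h
    have h0 : i ^ 2 + i * j + j ^ 2 = 0 := by exact_mod_cast h
    have hj : j = 0 := by
      have : j ^ 2 ≤ 0 := by nlinarith [sq_nonneg (2 * i + j)]
      exact pow_eq_zero_iff two_ne_zero |>.1 (le_antisymm this (sq_nonneg j))
    have hi : i = 0 := by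
      subst hj
      exact pow_eq_zero_iff two_ne_zero |>.1 (by linarith)
    exact hne ⟨hi, hj, by omega⟩
  have hxz : Real.log ‖x‖ = Real.log ‖z‖ := by
    have : ((i : ℝ) ^ 2 + i * j + j ^ 2) * (Real.log ‖x‖ - Real.log ‖z‖) = 0 := by
      linear_combination (i : ℝ) * e1 - (j : ℝ) * e2
    exact sub_eq_zero.1 ((mul_eq_zero.1 this).resolve_left hdet)
  have hyz : Real.log ‖y‖ = Real.log ‖z‖ := by
    have : ((i : ℝ) ^ 2 + i * j + j ^ 2) * (Real.log ‖y‖ - Real.log ‖z‖) = 0 := by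
      linear_combination ((i : ℝ) + j) * e1 + (i : ℝ) * e2
    exact sub_eq_zero.1 ((mul_eq_zero.1 this).resolve_left hdet)
  exact ⟨Real.log_injOn_pos (norm_pos_iff.2 hx) (norm_pos_iff.2 hz) hxz,
    Real.log_injOn_pos (norm_pos_iff.2 hy) (norm_pos_iff.2 hz) hyz⟩

open ComplexConjugate in
lemma mul_eq_sq_of_conj_of_norm_eq {t u v : ℂ} (htu : t ≠ u) (htv : t ≠ v) (huv : u ≠ v)
    (ht : conj t = t) (hu : conj u = t ∨ conj u = u ∨ conj u = v)
    (hv : conj v = t ∨ conj v = u ∨ conj v = v) (hn1 : ‖u‖ = ‖t‖) (hn2 : ‖v‖ = ‖t‖) :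
    u * v = t ^ 2 := by
  have real_case : ∀ w : ℂ, t ≠ w → conj w = w → ‖w‖ = ‖t‖ → w = -t := by
    intro w htw hw hn
    obtain ⟨r, rfl⟩ := Complex.conj_eq_iff_real.1 hw
    obtain ⟨s, rfl⟩ := Complex.conj_eq_iff_real.1 ht
    rw [Complex.norm_real, Complex.norm_real, Real.norm_eq_abs, Real.norm_eq_abs,
      abs_eq_abs] at hn
    rcases hn with rfl | rfl
    · exact absurd rfl htw
    · push_cast; ring
  have inv : ∀ {p q : ℂ}, conj p = q → p = conj q := fun h => by rw [← h, Complex.conj_conj]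
  rcases hu with h | h | h
  · exact absurd ((inv h).trans ht).symm htu
  · have hu' := real_case u htu h hn1
    rcases hv with h' | h' | h'
    · exact absurd ((inv h').trans ht).symm htv
    · exact absurd ((inv h').trans h).symm huv
    · exact absurd (hu'.trans (real_case v htv h' hn2).symm) huv
  · have h1 : u * v = (‖u‖ : ℂ) ^ 2 := by rw [← h, Complex.mul_conj']
    have h2 : t ^ 2 = (‖t‖ : ℂ) ^ 2 := by rw [← Complex.mul_conj', ht, sq]
    rw [h1, h2, hn1]

lemma rat_eq_int_of_root {q : ℚ} {f : ℤ[X]} (hf : f.Monic) (h : aeval q f = 0) :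
    ∃ m : ℤ, (m : ℚ) = q := by
  have hq : IsIntegral ℤ q := ⟨f, hf, h⟩
  obtain ⟨m, hm⟩ := IsIntegrallyClosed.isIntegral_iff.1 hq
  exact ⟨m, by simpa using hm⟩

/-- If a real root of an integral cubic without integer roots is a cube root of an integer
then the cubic is a pure one. -/
lemma pure_of_cube_root {a b c : ℤ} (h : ∀ m : ℤ, m ^ 3 + a * m ^ 2 + b * m + c ≠ 0)
    {t : ℂ} (ht : t ^ 3 + a * t ^ 2 + b * t + c = 0) (htc : t ^ 3 = -c) : a = 0 ∧ b = 0 := by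
  have hc : c ≠ 0 := fun hc => h 0 (by simp [hc])
  have ht0 : t ≠ 0 := by
    rintro rfl
    have : (c : ℂ) = 0 := by simpa using htc
    exact hc (by exact_mod_cast this)
  have hlin : (a : ℂ) * t + b = 0 := by
    have : t * ((a : ℂ) * t + b) = 0 := by linear_combination ht - htc
    exact (mul_eq_zero.1 this).resolve_left ht0
  by_cases ha : a = 0
  · subst ha
    refine ⟨rfl, ?_⟩
    have : (b : ℂ) = 0 := by simpa using hlin
    exact_mod_cast this
  · exfalso
    have ha' : (a : ℂ) ≠ 0 := by exact_mod_cast ha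
    have htq : t = ((-b / a : ℚ) : ℂ) := by
      push_cast
      field_simp
      linear_combination hlin
    set q : ℚ := -b / a
    have hq : q ^ 3 + a * q ^ 2 + b * q + c = 0 := by
      rw [htq] at ht
      exact_mod_cast ht
    obtain ⟨m, hm⟩ := rat_eq_int_of_root (q := q) (monicCubic_monic a b c)
      (by simpa [monicCubic] using hq)
    rw [← hm] at hq
    exact h m (by exact_mod_cast hq)

lemma vieta_of_distinct_roots {a b c x y z : ℂ} (hxy : x ≠ y) (hyz : y ≠ z) (hxz : x ≠ z)
    (hx : x ^ 3 + a * x ^ 2 + b * x + c = 0) (hy : y ^ 3 + a * y ^ 2 + b * y + c = 0)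
    (hz : z ^ 3 + a * z ^ 2 + b * z + c = 0) (w : ℂ) :
    w ^ 3 + a * w ^ 2 + b * w + c = (w - x) * (w - y) * (w - z) := by
  have e1 : x ^ 2 + x * y + y ^ 2 + a * (x + y) + b = 0 :=
    (mul_eq_zero.1 (by linear_combination hx - hy :
      (x - y) * (x ^ 2 + x * y + y ^ 2 + a * (x + y) + b) = 0)).resolve_left (sub_ne_zero.2 hxy)
  have e2 : z ^ 2 + z * y + y ^ 2 + a * (z + y) + b = 0 :=
    (mul_eq_zero.1 (by linear_combination hz - hy :
      (z - y) * (z ^ 2 + z * y + y ^ 2 + a * (z + y) + b) = 0)).resolve_left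
        (sub_ne_zero.2 hyz.symm)
  have e3 : x + y + z + a = 0 :=
    (mul_eq_zero.1 (by linear_combination e1 - e2 :
      (x - z) * (x + y + z + a) = 0)).resolve_left (sub_ne_zero.2 hxz)
  have ea : a = -(x + y + z) := by linear_combination e3
  subst ea
  have eb : b = x * y + y * z + x * z := by linear_combination e1
  subst eb
  linear_combination hx

lemma sq_eq_one_of_zpow_eq_one {n k : ℤ} (h : (n : ℂ) ^ k = 1) (hk : k ≠ 0) : n ^ 2 = 1 := by
  by_contra hn
  have h1 := congrArg norm h
  rw [norm_zpow, norm_one, Complex.norm_intCast, zpow_eq_one_iff_right₀ (abs_nonneg _)] at h1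
  · exact hk h1
  · intro h2
    apply hn
    rw [← sq_abs]
    have h3 : |n| = 1 := by exact_mod_cast h2
    rw [h3, one_pow]

/-- A degenerate integral cubic without integer roots is pure or has constant term `±1`. -/
lemma genDeg_no_root {a b c : ℤ} (h : ∀ m : ℤ, m ^ 3 + a * m ^ 2 + b * m + c ≠ 0)
    (hdeg : GenDeg (monicCubic a b c)) : c ^ 2 = 1 ∨ (a = 0 ∧ b = 0) := by
  have hc : c ≠ 0 := fun hc => h 0 (by simp [hc])
  have hcC : (c : ℂ) ≠ 0 := by exact_mod_cast hc
  obtain ⟨x, y, z, hxy, hyz, hxz, hx, hy, hz, hrot⟩ :=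
    exists_cyclic_roots (irreducible_map_monicCubic h)
      (by rw [(monicCubic_monic a b c).natDegree_map, monicCubic_natDegree])
  replace hx : x ^ 3 + a * x ^ 2 + b * x + c = 0 := by simpa [monicCubic] using hx
  replace hy : y ^ 3 + a * y ^ 2 + b * y + c = 0 := by simpa [monicCubic] using hy
  replace hz : z ^ 3 + a * z ^ 2 + b * z + c = 0 := by simpa [monicCubic] using hz
  have hfac := vieta_of_distinct_roots hxy hyz hxz hx hy hz
  have hprod : x * y * z = -c := by
    have := hfac 0
    linear_combination this
  have hne0 : ∀ w : ℂ, w ^ 3 + a * w ^ 2 + b * w + c = 0 → w ≠ 0 := by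
    rintro w hw rfl
    exact hcC (by simpa using hw)
  have hx0 := hne0 x hx
  have hy0 := hne0 y hy
  have hz0 := hne0 z hz
  have hmem : ∀ w : ℂ, w ^ 3 + a * w ^ 2 + b * w + c = 0 → w = x ∨ w = y ∨ w = z := by
    intro w hw
    rw [hfac w, mul_eq_zero, mul_eq_zero, sub_eq_zero, sub_eq_zero, sub_eq_zero, or_assoc] at hw
    exact hw
  have hS : nzRoots (monicCubic a b c) = {x, y, z} := by
    ext w
    rw [mem_nzRoots_monicCubic]
    simp only [Finset.mem_insert, Finset.mem_singleton]
    refine ⟨fun hw => hmem w hw.1, ?_⟩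
    rintro (rfl | rfl | rfl)
    exacts [⟨hx, hx0⟩, ⟨hy, hy0⟩, ⟨hz, hz0⟩]
  rw [genDeg_monicCubic_iff, hS] at hdeg
  obtain ⟨k, ⟨w, hw, hkw⟩, hk⟩ := hdeg
  rw [Finset.prod_insert (by simp [hxy, hxz]), Finset.prod_insert (by simp [hyz]),
    Finset.prod_singleton, ← mul_assoc] at hk
  have hk' := hrot _ _ _ hk
  have hne : ¬(k x = 0 ∧ k y = 0 ∧ k z = 0) := by
    rintro ⟨h1, h2, h3⟩
    simp only [Finset.mem_insert, Finset.mem_singleton] at hw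
    rcases hw with rfl | rfl | rfl <;> contradiction
  by_cases hsum : k x + k y + k z = 0
  · right
    obtain ⟨n1, n2⟩ := norm_eq_of_cyclic_relations hx0 hy0 hz0 hne hsum hk hk'
    have hconj : ∀ w : ℂ, w ^ 3 + a * w ^ 2 + b * w + c = 0 →
        starRingEnd ℂ w = x ∨ starRingEnd ℂ w = y ∨ starRingEnd ℂ w = z := by
      intro w hw
      refine hmem _ ?_
      have := congrArg (starRingEnd ℂ) hw
      simpa using this
    have cx := hconj x hx
    have cy := hconj y hy
    have cz := hconj z hz
    have inv : ∀ {p q : ℂ}, starRingEnd ℂ p = q → starRingEnd ℂ q = p := fun h => by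
      rw [← h, Complex.conj_conj]
    by_cases rx : starRingEnd ℂ x = x
    · have := mul_eq_sq_of_conj_of_norm_eq hxy hxz hyz rx cy cz (n2.trans n1.symm) n1.symm
      exact pure_of_cube_root h hx (by linear_combination hprod - x * this)
    by_cases ry : starRingEnd ℂ y = y
    · have := mul_eq_sq_of_conj_of_norm_eq hxy.symm hyz hxz ry (or_left_comm.1 cx) (or_left_comm.1 cz)
        (n1.trans n2.symm) n2.symm
      exact pure_of_cube_root h hy (by linear_combination hprod - y * this)
    have rz : starRingEnd ℂ z = z := by
      rcases cz with e | e | e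
      · exfalso
        rcases cy with e' | e' | e'
        · exact hyz ((inv e').symm.trans (inv e))
        · exact ry e'
        · exact hxy (e.symm.trans (inv e'))
      · exfalso
        rcases cx with e' | e' | e'
        · exact rx e'
        · exact hxz ((inv e').symm.trans (inv e))
        · exact hxy ((inv e').symm.trans e)
      · exact e
    have := mul_eq_sq_of_conj_of_norm_eq hxz.symm hyz.symm hxy rz (or_assoc.2 cx).symm
      (or_assoc.2 cy).symm n1 n2
    exact pure_of_cube_root h hz (by linear_combination hprod - z * this)
  · left
    have hk'' := hrot (k z) (k x) (k y) (by rw [← hk']; ring)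
    have hp : (x * y * z) ^ (k x + k y + k z) = 1 := by
      rw [mul_zpow, mul_zpow, zpow_add₀ hx0, zpow_add₀ hx0, zpow_add₀ hy0, zpow_add₀ hy0,
        zpow_add₀ hz0, zpow_add₀ hz0]
      calc _ = (x ^ k x * y ^ k y * z ^ k z) * (y ^ k x * z ^ k y * x ^ k z) *
          (y ^ k z * z ^ k x * x ^ k y) := by ring
        _ = 1 := by rw [hk, hk', hk'']; norm_num
    rw [hprod] at hp
    have hp' : ((-c : ℤ) : ℂ) ^ (k x + k y + k z) = 1 := by exact_mod_cast hp
    simpa using sq_eq_one_of_zpow_eq_one hp' hsum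

/-- A complex root of an integral monic quadratic without integer roots is not rational. -/
lemma ne_rat_of_no_int_root {p q : ℤ} (h : ∀ m : ℤ, m ^ 2 + p * m + q ≠ 0) {α : ℂ}
    (hα : α ^ 2 + p * α + q = 0) (r : ℚ) : α ≠ r := by
  rintro rfl
  have hr : r ^ 2 + p * r + q = 0 := by exact_mod_cast hα
  obtain ⟨m, hm⟩ := rat_eq_int_of_root (q := r) (f := X ^ 2 + C p * X + C q) (by monicity!)
    (by simpa using hr)
  rw [← hm] at hr
  exact h m (by exact_mod_cast hr)

lemma exists_pow_eq_linear (p q : ℤ) (d : ℕ) : ∃ u v : ℤ, ∀ α : ℂ, α ^ 2 + p * α + q = 0 →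
    α ^ d = u + v * α := by
  induction d with
  | zero => exact ⟨1, 0, fun α _ => by simp⟩
  | succ d ih =>
    obtain ⟨u, v, h⟩ := ih
    refine ⟨-q * v, u - p * v, fun α hα => ?_⟩
    rw [pow_succ, h α hα]
    push_cast
    linear_combination (v : ℂ) * hα

lemma pow_eq_pow_of_rational {p q : ℤ} (h : ∀ m : ℤ, m ^ 2 + p * m + q ≠ 0) {α β : ℂ}
    (hα : α ^ 2 + p * α + q = 0) (hβ : β ^ 2 + p * β + q = 0) {d : ℕ} {w : ℚ}
    (hw : α ^ d = w) : α ^ d = β ^ d := by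
  obtain ⟨u, v, huv⟩ := exists_pow_eq_linear p q d
  have hv : v = 0 := by
    by_contra hv
    have hv' : (v : ℂ) ≠ 0 := by exact_mod_cast hv
    refine ne_rat_of_no_int_root h hα ((w - u) / v) ?_
    push_cast
    rw [← hw, huv α hα]
    field_simp
    ring
  rw [huv α hα, huv β hβ, hv]
  simp

/-- A rational number of the form `ζ + ζ⁻¹`, with `ζ` a root of unity, is an integer between
`-2` and `2`. -/
lemma int_of_rat_eq_root_of_unity_add_inv {ζ : ℂ} {d : ℕ} (hd : d ≠ 0) (hζ : ζ ^ d = 1) {r : ℚ}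
    (hr : ζ + ζ⁻¹ = r) : ∃ t : ℤ, (t : ℚ) = r ∧ |t| ≤ 2 := by
  have integral : ∀ ξ : ℂ, ξ ^ d = 1 → IsIntegral ℤ ξ := fun ξ hξ =>
    IsIntegral.of_pow (Nat.pos_of_ne_zero hd) (hξ ▸ isIntegral_one)
  have hinv : ζ⁻¹ ^ d = 1 := by rw [inv_pow, hζ, inv_one]
  have h1 : IsIntegral ℤ (algebraMap ℚ ℂ r) := by
    rw [eq_ratCast, ← hr]
    exact (integral ζ hζ).add (integral _ hinv)
  rw [isIntegral_algebraMap_iff (algebraMap ℚ ℂ).injective] at h1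
  obtain ⟨t, ht⟩ := IsIntegrallyClosed.isIntegral_iff.1 h1
  have ht' : (t : ℚ) = r := by simpa using ht
  refine ⟨t, ht', ?_⟩
  have hn : ‖(t : ℂ)‖ ≤ 2 := by
    have : (t : ℂ) = ζ + ζ⁻¹ := by rw [hr, ← ht']; simp
    rw [this]
    refine (norm_add_le _ _).trans ?_
    rw [Complex.norm_eq_one_of_pow_eq_one hζ hd, Complex.norm_eq_one_of_pow_eq_one hinv hd]
    norm_num
  rw [Complex.norm_intCast] at hn
  exact_mod_cast hn

/-- If a product of powers, with distinct exponents, of the two roots of a quadratic without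
integer roots is rational, then the square of the trace is a small multiple of the norm. -/
lemma trace_sq_eq_of_relation {p q : ℤ} (h : ∀ m : ℤ, m ^ 2 + p * m + q ≠ 0) {α β : ℂ}
    (hs : α + β = -p) (hp : α * β = q) {j k : ℤ} (hjk : j ≠ k) {w : ℚ}
    (hw : α ^ j * β ^ k = w) : p = 0 ∨ ∃ t ∈ Finset.Icc (1 : ℤ) 4, t * q = p ^ 2 := by
  have hq : q ≠ 0 := fun hq => h 0 (by simp [hq])
  have hqC : (q : ℂ) ≠ 0 := by exact_mod_cast hq
  have hα0 : α ≠ 0 := by rintro rfl; exact hqC (by rw [← hp, zero_mul])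
  have hβ0 : β ≠ 0 := by rintro rfl; exact hqC (by rw [← hp, mul_zero])
  have hα : α ^ 2 + p * α + q = 0 := by linear_combination (-α) * hs.symm - hp
  have hβ : β ^ 2 + p * β + q = 0 := by linear_combination (-β) * hs.symm - hp
  have hrat : α ^ (j - k) = ((w * (q : ℚ) ^ (-k) : ℚ) : ℂ) := by
    push_cast
    rw [← hw, ← hp, mul_zpow, zpow_sub₀ hα0, zpow_neg, zpow_neg]
    have := zpow_ne_zero k hβ0
    have := zpow_ne_zero k hα0
    field_simp
  have hd : (j - k).natAbs ≠ 0 := by omega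
  have hpow : ∃ w' : ℚ, α ^ (j - k).natAbs = w' := by
    rcases Int.natAbs_eq (j - k) with e | e
    · rw [e, zpow_natCast] at hrat
      exact ⟨_, hrat⟩
    · rw [e, zpow_neg, zpow_natCast] at hrat
      refine ⟨(w * (q : ℚ) ^ (-k))⁻¹, ?_⟩
      rw [Rat.cast_inv, ← hrat, inv_inv]
  obtain ⟨w', hw'⟩ := hpow
  have heq := pow_eq_pow_of_rational h hα hβ hw'
  have hζ : (α / β) ^ (j - k).natAbs = 1 := by
    rw [div_pow, heq, div_self (pow_ne_zero _ hβ0)]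
  obtain ⟨t, ht, hle⟩ := int_of_rat_eq_root_of_unity_add_inv hd hζ
    (r := (p : ℚ) ^ 2 / q - 2) (by
      push_cast
      rw [inv_div, ← hp]
      field_simp
      have : (p : ℂ) = -(α + β) := by rw [hs, neg_neg]
      rw [this]
      ring)
  have hqQ : (q : ℚ) ≠ 0 := by exact_mod_cast hq
  have htq : (t + 2) * q = p ^ 2 := by
    have : ((t : ℚ) + 2) * q = p ^ 2 := by rw [ht]; field_simp; ring
    exact_mod_cast this
  rw [abs_le] at hle
  by_cases ht2 : t = -2
  · left
    rw [ht2] at htq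
    exact pow_eq_zero_iff two_ne_zero |>.1 (by linarith)
  · exact Or.inr ⟨t + 2, Finset.mem_Icc.2 ⟨by omega, by omega⟩, htq⟩

/-- The nonzero roots of a product of a linear factor and a quadratic without integer roots. -/
lemma exists_nzRoots_eq {p q : ℤ} (h : ∀ m : ℤ, m ^ 2 + p * m + q ≠ 0) (m : ℤ) :
    ∃ α β : ℂ, α + β = -p ∧ α * β = q ∧ α ≠ β ∧ α ≠ m ∧ β ≠ m ∧
      nzRoots (monicCubic (p - m) (q - m * p) (-(m * q))) =
        if m = 0 then {α, β} else {(m : ℂ), α, β} := by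
  obtain ⟨α, hα⟩ := IsAlgClosed.exists_root (X ^ 2 + C (p : ℂ) * X + C (q : ℂ)) (by
    have : (X ^ 2 + C (p : ℂ) * X + C (q : ℂ)).degree = 2 := by compute_degree!
    rw [this]; norm_num)
  replace hα : α ^ 2 + p * α + q = 0 := by simpa using hα
  obtain ⟨β, hβdef⟩ : ∃ β : ℂ, β = -p - α := ⟨_, rfl⟩
  have hs : α + β = -p := by rw [hβdef]; ring
  have hp : α * β = q := by rw [hβdef]; linear_combination -hα
  have hβ : β ^ 2 + p * β + q = 0 := by linear_combination (-β) * hs.symm - hp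
  have hirr := ne_rat_of_no_int_root h hα
  have hirr' := ne_rat_of_no_int_root h hβ
  refine ⟨α, β, hs, hp, ?_, by simpa using hirr m, by simpa using hirr' m, ?_⟩
  · rintro rfl
    refine hirr (-p / 2) ?_
    push_cast
    linear_combination hs / 2
  · have hα0 : α ≠ 0 := by simpa using hirr 0
    have hβ0 : β ≠ 0 := by simpa using hirr' 0
    have key : ∀ w : ℂ, w ∈ nzRoots (monicCubic (p - m) (q - m * p) (-(m * q))) ↔
        (w = m ∨ w = α ∨ w = β) ∧ w ≠ 0 := by
      intro w
      rw [mem_nzRoots_monicCubic]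
      refine and_congr_left fun _ => ?_
      rw [← sub_eq_zero (a := w) (b := (m : ℂ)), ← sub_eq_zero (a := w) (b := α), ← sub_eq_zero (a := w) (b := β),
        ← mul_eq_zero, ← mul_eq_zero]
      refine Eq.congr_left ?_
      push_cast
      linear_combination (w - m) * (w * hs - hp)
    ext w
    rw [key]
    split_ifs with hm
    · subst hm
      simp only [Finset.mem_insert, Finset.mem_singleton, Int.cast_zero]
      constructor
      · tauto
      · rintro (rfl | rfl) <;> tauto
    · have hmC : (m : ℂ) ≠ 0 := by exact_mod_cast hm
      simp only [Finset.mem_insert, Finset.mem_singleton]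
      constructor
      · tauto
      · rintro (rfl | rfl | rfl) <;> tauto

/-- Every prime divisor of an integer occurring nontrivially in a multiplicative relation divides
another integer of the relation. -/
lemma exists_ne_dvd_of_relation {S : Finset ℤ} {k : ℤ → ℤ}
    (hk : ∏ x ∈ S, (x : ℂ) ^ k x = 1) {x : ℤ} (hx : x ∈ S) (hkx : k x ≠ 0) {r : ℕ}
    (hr : r.Prime) (hrx : (r : ℤ) ∣ x) : ∃ y ∈ S, y ≠ x ∧ (r : ℤ) ∣ y := by
  classical
  by_contra! hcon
  have : Fact r.Prime := ⟨hr⟩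
  have hQ : ∏ x ∈ S, (x : ℚ) ^ k x = 1 := by
    have h : ((∏ x ∈ S, (x : ℚ) ^ k x : ℚ) : ℂ) = 1 := by
      push_cast
      exact hk
    exact_mod_cast h
  have hP : ∏ x ∈ S, (x : ℚ_[r]) ^ k x = 1 := by
    have := congrArg (fun t : ℚ => (t : ℚ_[r])) hQ
    push_cast at this
    exact this
  have hn := congrArg norm hP
  rw [norm_prod, norm_one, Finset.prod_eq_single_of_mem x hx] at hn
  · rw [norm_zpow, zpow_eq_one_iff_right₀ (norm_nonneg _)] at hn
    · exact hkx hn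
    · exact (Padic.norm_intCast_lt_one_iff.2 hrx).ne
  · intro y hy hyx
    have h1 : ‖(y : ℚ_[r])‖ = 1 := by
      refine le_antisymm (Padic.norm_int_le_one y) (not_lt.1 fun hlt => ?_)
      exact hcon y hy hyx (Padic.norm_intCast_lt_one_iff.1 hlt)
    rw [norm_zpow, h1, one_zpow]

/-- In a degenerate cubic with three integer roots, the roots can be ordered so that every prime
divisor of the first divides the product of the other two. -/
lemma exists_root_radical_dvd {m n l : ℤ} (hm : m ≠ 0) (hn : n ≠ 0) (hl : l ≠ 0)
    (hdeg : GenDeg (monicCubic (-(m + n + l)) (m * n + n * l + l * m) (-(m * n * l)))) :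
    ∃ m' n' l' : ℤ, m' ≠ 0 ∧ n' ≠ 0 ∧ l' ≠ 0 ∧ m + n + l = m' + n' + l' ∧
      m * n + n * l + l * m = m' * n' + n' * l' + l' * m' ∧ m * n * l = m' * n' * l' ∧
      ∀ r : ℕ, r.Prime → (r : ℤ) ∣ m' → (r : ℤ) ∣ n' * l' := by
  classical
  rw [genDeg_monicCubic_iff] at hdeg
  have hS : nzRoots (monicCubic (-(m + n + l)) (m * n + n * l + l * m) (-(m * n * l))) =
      ({m, n, l} : Finset ℤ).image (fun x : ℤ => (x : ℂ)) := by
    ext w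
    have key : w ^ 3 + ((-(m + n + l) : ℤ) : ℂ) * w ^ 2 +
        ((m * n + n * l + l * m : ℤ) : ℂ) * w + ((-(m * n * l) : ℤ) : ℂ) =
        (w - m) * ((w - n) * (w - l)) := by
      push_cast; ring
    rw [mem_nzRoots_monicCubic, key, mul_eq_zero, mul_eq_zero, sub_eq_zero, sub_eq_zero,
      sub_eq_zero]
    simp only [Finset.mem_image, Finset.mem_insert, Finset.mem_singleton]
    constructor
    · rintro ⟨rfl | rfl | rfl, -⟩
      exacts [⟨m, by simp, rfl⟩, ⟨n, by simp, rfl⟩, ⟨l, by simp, rfl⟩]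
    · rintro ⟨x, rfl | rfl | rfl, rfl⟩
      exacts [⟨by simp, by exact_mod_cast hm⟩, ⟨by simp, by exact_mod_cast hn⟩,
        ⟨by simp, by exact_mod_cast hl⟩]
  obtain ⟨k, ⟨z, hz, hkz⟩, hk⟩ := hdeg
  rw [hS] at hz hk
  rw [Finset.prod_image (fun x _ y _ hxy => Int.cast_injective hxy)] at hk
  obtain ⟨x, hx, rfl⟩ := Finset.mem_image.1 hz
  have hdvd : ∀ r : ℕ, r.Prime → (r : ℤ) ∣ x → ∃ y, (y = m ∨ y = n ∨ y = l) ∧ y ≠ x ∧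
      (r : ℤ) ∣ y := by
    intro r hr hrx
    obtain ⟨y, hy, hyx, hry⟩ :=
      exists_ne_dvd_of_relation (k := fun y => k y) hk hx hkz hr hrx
    exact ⟨y, by simpa using hy, hyx, hry⟩
  simp only [Finset.mem_insert, Finset.mem_singleton] at hx
  rcases hx with rfl | rfl | rfl
  · refine ⟨x, n, l, hm, hn, hl, rfl, rfl, rfl, fun r hr hrx => ?_⟩
    obtain ⟨y, rfl | rfl | rfl, hyx, hry⟩ := hdvd r hr hrx
    exacts [absurd rfl hyx, hry.mul_right _, hry.mul_left _]
  · refine ⟨x, m, l, hn, hm, hl, by ring, by ring, by ring, fun r hr hrx => ?_⟩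
    obtain ⟨y, rfl | rfl | rfl, hyx, hry⟩ := hdvd r hr hrx
    exacts [hry.mul_right _, absurd rfl hyx, hry.mul_left _]
  · refine ⟨x, m, n, hl, hm, hn, by ring, by ring, by ring, fun r hr hrx => ?_⟩
    obtain ⟨y, rfl | rfl | rfl, hyx, hry⟩ := hdvd r hr hrx
    exacts [hry.mul_right _, hry.mul_left _, absurd rfl hyx]

/-- Multiplicatively dependent integers outside `{-1, 0, 1}` are, up to sign, powers of a common
base. -/
lemma exists_common_base {m q : ℤ} (hm : 2 ≤ m.natAbs) (hq : 2 ≤ q.natAbs) {i j : ℤ} (hij : i ≠ 0 ∨ j ≠ 0)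
    (h : (m : ℂ) ^ i * (q : ℂ) ^ j = 1) :
    ∃ g s t : ℕ, 2 ≤ g ∧ 1 ≤ s ∧ 1 ≤ t ∧ m.natAbs = g ^ s ∧ q.natAbs = g ^ t := by
  have hM : (1 : ℝ) < m.natAbs := by
    have : 1 < m.natAbs := by omega
    exact_mod_cast this
  have hQ : (1 : ℝ) < q.natAbs := by
    have : 1 < q.natAbs := by omega
    exact_mod_cast this
  have hn : (m.natAbs : ℝ) ^ i * (q.natAbs : ℝ) ^ j = 1 := by
    have := congrArg norm h
    rw [norm_mul, norm_zpow, norm_zpow, norm_one, Complex.norm_intCast, Complex.norm_intCast] at this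
    simpa [Nat.cast_natAbs] using this
  have hlog : i * Real.log m.natAbs + j * Real.log q.natAbs = 0 := by
    have := congrArg Real.log hn
    rwa [Real.log_mul (by positivity) (by positivity), Real.log_zpow, Real.log_zpow,
      Real.log_one] at this
  have lM := Real.log_pos hM
  have lQ := Real.log_pos hQ
  obtain ⟨I, J, hI, hJ, hpow⟩ : ∃ I J : ℕ, I ≠ 0 ∧ J ≠ 0 ∧ m.natAbs ^ I = q.natAbs ^ J := by
    have hi : i ≠ 0 := by
      rintro rfl
      have hj := hij.resolve_left (by simp)
      have hj' : (j : ℝ) ≠ 0 := by exact_mod_cast hj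
      have : (j : ℝ) * Real.log q.natAbs = 0 := by simpa using hlog
      exact (mul_ne_zero hj' lQ.ne') this
    have hj : j ≠ 0 := by
      rintro rfl
      have hi' : (i : ℝ) ≠ 0 := by exact_mod_cast hi
      have : (i : ℝ) * Real.log m.natAbs = 0 := by simpa using hlog
      exact (mul_ne_zero hi' lM.ne') this
    refine ⟨i.natAbs, j.natAbs, by simpa, by simpa, ?_⟩
    have habs : (i.natAbs : ℝ) * Real.log m.natAbs = j.natAbs * Real.log q.natAbs := by
      have e : (i : ℝ) * Real.log m.natAbs = -(j * Real.log q.natAbs) := by linarith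
      have := congrArg abs e
      rw [abs_neg, abs_mul, abs_mul, abs_of_pos lM, abs_of_pos lQ] at this
      simpa [Nat.cast_natAbs] using this
    rw [← Real.log_pow, ← Real.log_pow] at habs
    have := Real.log_injOn_pos (Set.mem_Ioi.2 (by positivity)) (Set.mem_Ioi.2 (by positivity)) habs
    exact_mod_cast this
  obtain ⟨g, hg1, hg2⟩ := Nat.exists_eq_pow_of_pow_eq_pow (Or.inl hI) hpow
  refine ⟨g, _, _, ?_, Nat.div_pos (Nat.le_of_dvd (Nat.pos_of_ne_zero hJ) (Nat.gcd_dvd_right I J))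
    (Nat.gcd_pos_of_pos_left _ (Nat.pos_of_ne_zero hI)),
    Nat.div_pos (Nat.le_of_dvd (Nat.pos_of_ne_zero hI) (Nat.gcd_dvd_left I J))
    (Nat.gcd_pos_of_pos_left _ (Nat.pos_of_ne_zero hI)), hg1, hg2⟩
  by_contra! hg
  have hpos : J / Nat.gcd I J ≠ 0 :=
    (Nat.div_pos (Nat.le_of_dvd (Nat.pos_of_ne_zero hJ) (Nat.gcd_dvd_right I J))
      (Nat.gcd_pos_of_pos_left _ (Nat.pos_of_ne_zero hI))).ne'
  have : m.natAbs ≤ 1 := by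
    rw [hg1]
    exact Nat.pow_le_one_iff hpos |>.2 (by omega)
  omega

/-- Classification of the degenerate cubics that have neither constant term `±1` nor root `±1`. -/
lemma genDeg_classification {a b c : ℤ} (hdeg : GenDeg (monicCubic a b c)) (hc : c ^ 2 ≠ 1)
    (h1 : 1 + a + b + c ≠ 0) (h2 : -1 + a - b + c ≠ 0) :
    (a = 0 ∧ b = 0) ∨ (c = 0 ∧ b = 0) ∨
    (c = 0 ∧ ∃ n l : ℤ, n ≠ 0 ∧ l ≠ 0 ∧ a = -(n + l) ∧ b = n * l) ∨
    (c = 0 ∧ (a = 0 ∨ b ^ 2 = 1 ∨ ∃ t ∈ Finset.Icc (1 : ℤ) 4, t * b = a ^ 2)) ∨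
    (∃ m p q : ℤ, m ≠ 0 ∧ q ≠ 0 ∧ a = p - m ∧ b = q - m * p ∧ c = -(m * q) ∧
      (q ^ 2 = 1 ∨ p = 0 ∨ (∃ t ∈ Finset.Icc (1 : ℤ) 4, t * q = p ^ 2) ∨
        ∃ g s t : ℕ, 2 ≤ g ∧ 1 ≤ s ∧ 1 ≤ t ∧ m.natAbs = g ^ s ∧ q.natAbs = g ^ t)) ∨
    (∃ m n l : ℤ, m ≠ 0 ∧ n ≠ 0 ∧ l ≠ 0 ∧ a = -(m + n + l) ∧ b = m * n + n * l + l * m ∧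
      c = -(m * n * l) ∧ ∀ r : ℕ, r.Prime → (r : ℤ) ∣ m → (r : ℤ) ∣ n * l) := by
  by_cases hroot : ∀ m : ℤ, m ^ 3 + a * m ^ 2 + b * m + c ≠ 0
  · exact Or.inl ((genDeg_no_root hroot hdeg).resolve_left hc)
  right
  push Not at hroot
  obtain ⟨m, p, q, rfl, rfl, rfl, hm0⟩ : ∃ m p q : ℤ, a = p - m ∧ b = q - m * p ∧
      c = -(m * q) ∧ (c = 0 → m = 0) := by
    by_cases hc0 : c = 0
    · exact ⟨0, a, b, by ring, by ring, by rw [hc0]; ring, fun _ => rfl⟩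
    · obtain ⟨m, hm⟩ := hroot
      exact ⟨m, a + m, b + m * (a + m), by ring, by ring, by linear_combination hm,
        fun h => absurd h hc0⟩
  have hmq : m ≠ 0 → q ≠ 0 := by
    rintro hm rfl
    exact hm (hm0 (by ring))
  by_cases hquad : ∀ n : ℤ, n ^ 2 + p * n + q ≠ 0
  · have hq : q ≠ 0 := fun hq => hquad 0 (by simp [hq])
    obtain ⟨α, β, hs, hp, hαβ, hαm, hβm, hS⟩ := exists_nzRoots_eq hquad m
    rw [genDeg_monicCubic_iff, hS] at hdeg
    obtain ⟨k, ⟨z, hz, hkz⟩, hk⟩ := hdeg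
    by_cases hm : m = 0
    · right; right; left
      refine ⟨by rw [hm]; ring, ?_⟩
      rw [if_pos hm] at hz hk
      rw [Finset.prod_pair hαβ] at hk
      simp only [hm, sub_zero, zero_mul]
      by_cases hjk : k α = k β
      · right; left
        rw [← hjk, ← mul_zpow, hp] at hk
        refine sq_eq_one_of_zpow_eq_one hk fun h0 => hkz ?_
        simp only [Finset.mem_insert, Finset.mem_singleton] at hz
        rcases hz with rfl | rfl
        exacts [h0, hjk ▸ h0]
      · rcases trace_sq_eq_of_relation hquad hs hp hjk (w := 1) (by simpa using hk) with h | h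
        exacts [Or.inl h, Or.inr (Or.inr h)]
    · right; right; right; left
      refine ⟨m, p, q, hm, hq, rfl, rfl, rfl, ?_⟩
      have hmC : (m : ℂ) ≠ 0 := by exact_mod_cast hm
      rw [if_neg hm] at hz hk
      rw [Finset.prod_insert (by simp [hαm.symm, hβm.symm]), Finset.prod_pair hαβ] at hk
      by_cases hjk : k α = k β
      · by_cases hq1 : q ^ 2 = 1
        · exact Or.inl hq1
        right; right; right
        rw [← hjk, ← mul_zpow, hp] at hk
        have hm2 : 2 ≤ m.natAbs := by
          by_contra hlt
          have hm1 : m = 1 ∨ m = -1 := by omega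
          rcases hm1 with rfl | rfl
          · exact h1 (by ring)
          · exact h2 (by ring)
        have hq2 : 2 ≤ q.natAbs := by
          by_contra hlt
          have hq1' : q = 1 ∨ q = -1 := by omega
          rcases hq1' with rfl | rfl <;> norm_num at hq1
        refine exists_common_base hm2 hq2 ?_ hk
        by_contra! h0
        simp only [Finset.mem_insert, Finset.mem_singleton] at hz
        rcases hz with rfl | rfl | rfl
        exacts [hkz h0.1, hkz h0.2, hkz (hjk ▸ h0.2)]
      · have hw : α ^ k α * β ^ k β = (((m : ℚ) ^ (-k m) : ℚ) : ℂ) := by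
          push_cast
          rw [zpow_neg]
          exact eq_inv_of_mul_eq_one_right hk
        rcases trace_sq_eq_of_relation hquad hs hp hjk hw with h | h
        exacts [Or.inr (Or.inl h), Or.inr (Or.inr (Or.inl h))]
  · push Not at hquad
    obtain ⟨n, hn⟩ := hquad
    obtain ⟨l, rfl⟩ : ∃ l, p = -(n + l) := ⟨-p - n, by ring⟩
    obtain rfl : q = n * l := by linear_combination hn
    by_cases hm : m = 0
    · subst hm
      by_cases hnl : n * l = 0
      · left
        exact ⟨by ring, by rw [hnl]; ring⟩
      · right; left
        exact ⟨by ring, n, l, left_ne_zero_of_mul hnl, right_ne_zero_of_mul hnl, by ring, by ring⟩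
    · right; right; right; right
      have hnl := hmq hm
      have ea : -(n + l) - m = -(m + n + l) := by ring
      have eb : n * l - m * -(n + l) = m * n + n * l + l * m := by ring
      have ec : -(m * (n * l)) = -(m * n * l) := by ring
      rw [ea, eb, ec] at hdeg ⊢
      obtain ⟨m', n', l', hm', hn', hl', e1, e2, e3, hd⟩ := exists_root_radical_dvd hm
        (left_ne_zero_of_mul hnl) (right_ne_zero_of_mul hnl) hdeg
      exact ⟨m', n', l', hm', hn', hl', by rw [e1], e2, by rw [e3], hd⟩

lemma card_le_card_of_cover {α β : Type*} {S : Finset β} (P : Finset α) (F : α → β)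
    (h : ∀ x ∈ S, ∃ y ∈ P, F y = x) : S.card ≤ P.card := by
  classical
  exact (Finset.card_le_card fun x hx => Finset.mem_image.2 (h x hx)).trans
    (Finset.card_image_le (s := P) (f := F))

/-- Pairs of positive integers with product at most `N`. -/
def natHyperbola (N : ℕ) : Finset ((_ : ℕ) × ℕ) :=
  (Finset.Icc 1 N).sigma fun x => Finset.Icc 1 (N / x)

lemma mem_natHyperbola {N x y : ℕ} (hx : x ≠ 0) (hy : y ≠ 0) (h : x * y ≤ N) :
    ⟨x, y⟩ ∈ natHyperbola N := by
  have hx' : 0 < x := Nat.pos_of_ne_zero hx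
  have hy' : 0 < y := Nat.pos_of_ne_zero hy
  refine Finset.mem_sigma.2 ⟨Finset.mem_Icc.2 ⟨hx', ?_⟩, Finset.mem_Icc.2 ⟨hy', ?_⟩⟩
  · exact (Nat.le_mul_of_pos_right x hy').trans h
  · rw [Nat.le_div_iff_mul_le hx']
    rwa [mul_comm]

lemma card_natHyperbola_le (N : ℕ) : ((natHyperbola N).card : ℝ) ≤ N * (1 + Real.log N) := by
  have h1 : (harmonic N : ℝ) = ∑ x ∈ Finset.Icc 1 N, (x : ℝ)⁻¹ := by
    rw [harmonic_eq_sum_Icc]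
    push_cast
    rfl
  calc ((natHyperbola N).card : ℝ) = ∑ x ∈ Finset.Icc 1 N, ((N / x : ℕ) : ℝ) := by
        rw [natHyperbola, Finset.card_sigma]
        simp
    _ ≤ ∑ x ∈ Finset.Icc 1 N, (N : ℝ) * (x : ℝ)⁻¹ := by
        refine Finset.sum_le_sum fun x _ => ?_
        rw [← div_eq_mul_inv]
        exact Nat.cast_div_le
    _ = N * harmonic N := by rw [h1, Finset.mul_sum]
    _ ≤ N * (1 + Real.log N) := by
        gcongr
        exact harmonic_le_one_add_log N

/-- The two units of `ℤ`. -/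
def signs : Finset ℤ := {1, -1}

lemma card_signs : signs.card = 2 := rfl

lemma exists_sign_mul_natAbs (x : ℤ) : ∃ ε ∈ signs, ε * (x.natAbs : ℤ) = x := by
  rcases Int.natAbs_eq x with h | h
  · exact ⟨1, by simp [signs], by omega⟩
  · exact ⟨-1, by simp [signs], by omega⟩

/-- Pairs of nonzero integers whose product is at most `N` in absolute value. -/
def intHyperbola (N : ℕ) : Finset (ℤ × ℤ) :=
  (signs ×ˢ signs ×ˢ natHyperbola N).image fun v => (v.1 * v.2.2.1, v.2.1 * v.2.2.2)

lemma mem_intHyperbola {N : ℕ} {x y : ℤ} (hx : x ≠ 0) (hy : y ≠ 0) (h : |x * y| ≤ N) :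
    (x, y) ∈ intHyperbola N := by
  obtain ⟨ε, hε, ex⟩ := exists_sign_mul_natAbs x
  obtain ⟨δ, hδ, ey⟩ := exists_sign_mul_natAbs y
  refine Finset.mem_image.2 ⟨(ε, δ, ⟨x.natAbs, y.natAbs⟩), ?_, ?_⟩
  · refine Finset.mem_product.2 ⟨hε, Finset.mem_product.2 ⟨hδ, ?_⟩⟩
    refine mem_natHyperbola (by simpa) (by simpa) ?_
    rw [← Int.natAbs_mul]
    rw [Int.abs_eq_natAbs] at h
    exact_mod_cast h
  · simp only [ex, ey]

lemma card_intHyperbola_le (N : ℕ) :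
    ((intHyperbola N).card : ℝ) ≤ 4 * (N * (1 + Real.log N)) := by
  have h1 : (intHyperbola N).card ≤ 4 * (natHyperbola N).card := by
    refine Finset.card_image_le.trans ?_
    rw [Finset.card_product, Finset.card_product, card_signs]
    omega
  have h2 : ((intHyperbola N).card : ℝ) ≤ 4 * ((natHyperbola N).card : ℝ) := by exact_mod_cast h1
  linarith [card_natHyperbola_le N]

/-- Integers of absolute value at most `N`. -/
noncomputable def absBall (N : ℕ) : Finset ℤ := Finset.Icc (-N : ℤ) N

lemma mem_absBall {N : ℕ} {x : ℤ} : x ∈ absBall N ↔ |x| ≤ N := by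
  rw [absBall, Finset.mem_Icc, abs_le]

lemma card_absBall (N : ℕ) : (absBall N).card = 2 * N + 1 := by
  rw [absBall, Int.card_Icc]
  omega

/-- Pairs `(m, p)` of integers with `m` nonzero, `|m| ≤ N` and `|m p| ≤ 2 N`. -/
noncomputable def slopePairs (N : ℕ) : Finset (ℤ × ℤ) :=
  intHyperbola (2 * N) ∪ (absBall N).image fun m => (m, 0)

lemma card_slopePairs_le {N : ℕ} (hN : 3 ≤ N) :
    ((slopePairs N).card : ℝ) ≤ 20 * (N * (1 + Real.log N)) := by
  have h1 : (slopePairs N).card ≤ (intHyperbola (2 * N)).card + (2 * N + 1) := by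
    refine (Finset.card_union_le _ _).trans (Nat.add_le_add_left ?_ _)
    exact Finset.card_image_le.trans (card_absBall N).le
  have h2 : ((slopePairs N).card : ℝ) ≤ (intHyperbola (2 * N)).card + (2 * N + 1) := by
    exact_mod_cast h1
  have h3 := card_intHyperbola_le (2 * N)
  push_cast at h3
  have hN' : (3 : ℝ) ≤ N := by exact_mod_cast hN
  rw [Real.log_mul (by norm_num) (by positivity)] at h3
  have hlog : 0 ≤ Real.log N := Real.log_nonneg (by linarith)
  have hl2 : Real.log 2 ≤ 1 := by
    have := Real.log_two_lt_d9
    linarith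
  have : (N : ℝ) * Real.log 2 ≤ N * 1 := by gcongr
  nlinarith [mul_nonneg (by linarith : (0 : ℝ) ≤ N) hlog]

lemma mem_slopePairs {N : ℕ} {m p q : ℤ} (hm : m ≠ 0) (hq : q ≠ 0) (h1 : |q - m * p| ≤ N)
    (h2 : |m * q| ≤ N) : (m, p) ∈ slopePairs N := by
  have hm1 : 1 ≤ |m| := Int.one_le_abs hm
  have hq1 : 1 ≤ |q| := Int.one_le_abs hq
  rw [abs_mul] at h2
  by_cases hp : p = 0
  · subst hp
    refine Finset.mem_union_right _ (Finset.mem_image.2 ⟨m, mem_absBall.2 ?_, rfl⟩)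
    nlinarith
  · refine Finset.mem_union_left _ (mem_intHyperbola hm hp ?_)
    have h3 : |m * p| ≤ |q| + |q - m * p| := by
      have := abs_sub_abs_le_abs_sub (m * p) q
      rw [abs_sub_comm (m * p) q] at this
      linarith
    push_cast
    nlinarith

lemma sum_inv_mul_log_le {N : ℕ} (hN : 2 ≤ N) :
    ∑ g ∈ Finset.Icc 2 N, ((g : ℝ) * Real.log g)⁻¹ ≤
      (2 * Real.log 2)⁻¹ + Real.log (Real.log N) - Real.log (Real.log 2) := by
  induction N, hN using Nat.le_induction with
  | base => simp
  | succ n hn ih =>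
    rw [Finset.sum_Icc_succ_top (by omega)]
    have hn' : (2 : ℝ) ≤ n := by exact_mod_cast hn
    have step : ∀ u v : ℝ, 0 < u → 0 < v → (v - u) / v ≤ Real.log v - Real.log u := by
      intro u v hu hv
      have := Real.log_le_sub_one_of_pos (div_pos hu hv)
      rw [Real.log_div hu.ne' hv.ne'] at this
      have e : (v - u) / v = 1 - u / v := by field_simp
      linarith
    have hl : 0 < Real.log n := Real.log_pos (by linarith)
    have hl' : 0 < Real.log ((n + 1 : ℕ) : ℝ) := Real.log_pos (by push_cast; linarith)
    have s1 := step n ((n + 1 : ℕ) : ℝ) (by linarith) (by push_cast; linarith)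
    have s2 := step _ _ hl hl'
    have s3 : (((n + 1 : ℕ) : ℝ) * Real.log ((n + 1 : ℕ) : ℝ))⁻¹ ≤
        (Real.log ((n + 1 : ℕ) : ℝ) - Real.log n) / Real.log ((n + 1 : ℕ) : ℝ) := by
      rw [mul_inv, ← div_eq_mul_inv]
      gcongr
      refine le_trans (le_of_eq ?_) s1
      push_cast
      field_simp
      ring
    linarith

lemma sum_inv_sq_le_two (N : ℕ) : ∑ x ∈ Finset.Icc 1 N, ((x : ℝ) ^ 2)⁻¹ ≤ 2 := by
  suffices h : ∑ x ∈ Finset.Icc 1 N, ((x : ℝ) ^ 2)⁻¹ ≤ 2 - (N : ℝ)⁻¹ from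
    h.trans (sub_le_self _ (by positivity))
  induction N with
  | zero => simp
  | succ n ih =>
    rw [Finset.sum_Icc_succ_top (by omega)]
    rcases Nat.eq_zero_or_pos n with rfl | hn
    · norm_num
    · have hn' : (0 : ℝ) < n := by exact_mod_cast hn
      have : (((n + 1 : ℕ) : ℝ) ^ 2)⁻¹ ≤ (n : ℝ)⁻¹ - ((n + 1 : ℕ) : ℝ)⁻¹ := by
        push_cast
        rw [inv_sub_inv hn'.ne' (by positivity), inv_eq_one_div,
          div_le_div_iff₀ (by positivity) (by positivity)]
        nlinarith
      linarith

lemma sum_inv_pow_le {g : ℕ} (hg : 2 ≤ g) (K : ℕ) :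
    ∑ s ∈ Finset.Icc 1 K, ((g : ℝ) ^ s)⁻¹ ≤ 2 / g := by
  have hg' : (2 : ℝ) ≤ g := by exact_mod_cast hg
  suffices h : ∑ s ∈ Finset.Icc 1 K, ((g : ℝ) ^ s)⁻¹ ≤ 2 / g - 2 * ((g : ℝ) ^ (K + 1))⁻¹ from
    h.trans (sub_le_self _ (by positivity))
  induction K with
  | zero =>
    simp [div_eq_mul_inv]
  | succ n ih =>
    rw [Finset.sum_Icc_succ_top (by omega)]
    have : 2 * ((g : ℝ) ^ (n + 1 + 1))⁻¹ ≤ ((g : ℝ) ^ (n + 1))⁻¹ := by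
      rw [pow_succ (g : ℝ) (n + 1), mul_inv, ← mul_assoc, mul_comm 2, mul_assoc]
      refine mul_le_of_le_one_right (by positivity) ?_
      rw [← div_eq_mul_inv, div_le_one (by linarith)]
      exact hg'
    linarith

/-- Data `(g, s, t, p)` describing products of `X ± g ^ s` with `X ^ 2 + p X ± g ^ t`. -/
noncomputable def powerData (N : ℕ) : Finset ((_ : ℕ) × (_ : ℕ × ℕ) × ℤ) :=
  (Finset.Icc 2 N).sigma fun g =>
    (Finset.Icc 1 (Nat.log g N) ×ˢ Finset.Icc 1 (Nat.log g N)).sigma fun v =>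
      absBall (2 * N / g ^ v.1)

lemma card_powerData_le {N : ℕ} (hN : 3 ≤ N) :
    ((powerData N).card : ℝ) ≤ 10 * N * Real.log N *
      ((2 * Real.log 2)⁻¹ + Real.log (Real.log N) - Real.log (Real.log 2)) := by
  have hN0 : N ≠ 0 := by omega
  have hlogN : 0 ≤ Real.log N := Real.log_natCast_nonneg N
  have hcard : ((powerData N).card : ℝ) = ∑ g ∈ Finset.Icc 2 N,
      ∑ s ∈ Finset.Icc 1 (Nat.log g N), ∑ t ∈ Finset.Icc 1 (Nat.log g N),
        ((2 * (2 * N / g ^ s) + 1 : ℕ) : ℝ) := by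
    rw [powerData, Finset.card_sigma, Nat.cast_sum]
    refine Finset.sum_congr rfl fun g _ => ?_
    rw [Finset.card_sigma, Nat.cast_sum, Finset.sum_product]
    simp only [card_absBall]
  rw [hcard]
  calc _ ≤ ∑ g ∈ Finset.Icc 2 N, 10 * N * Real.log N * ((g : ℝ) * Real.log g)⁻¹ := by
        refine Finset.sum_le_sum fun g hg => ?_
        have hg2 : 2 ≤ g := (Finset.mem_Icc.1 hg).1
        have hg' : (2 : ℝ) ≤ g := by exact_mod_cast hg2
        have hlogg : 0 < Real.log g := Real.log_pos (by linarith)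
        have hlog : (Nat.log g N : ℝ) ≤ Real.log N / Real.log g := by
          rw [le_div_iff₀ hlogg, ← Real.log_pow]
          refine Real.log_le_log (by positivity) ?_
          exact_mod_cast Nat.pow_log_le_self g hN0
        calc _ ≤ ∑ s ∈ Finset.Icc 1 (Nat.log g N), (Real.log N / Real.log g) *
              (5 * N * ((g : ℝ) ^ s)⁻¹) := by
              refine Finset.sum_le_sum fun s hs => ?_
              rw [Finset.sum_const, Nat.card_Icc, nsmul_eq_mul, Nat.add_sub_cancel]
              refine mul_le_mul hlog ?_ (by positivity) (by positivity)
              have hsN : g ^ s ≤ N := Nat.pow_le_of_le_log hN0 (Finset.mem_Icc.1 hs).2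
              have hsN' : (g : ℝ) ^ s ≤ N := by exact_mod_cast hsN
              have hgs : (0 : ℝ) < (g : ℝ) ^ s := by positivity
              have h1 : ((2 * N / g ^ s : ℕ) : ℝ) ≤ 2 * N * ((g : ℝ) ^ s)⁻¹ := by
                have := Nat.cast_div_le (α := ℝ) (m := 2 * N) (n := g ^ s)
                push_cast at this
                rwa [div_eq_mul_inv] at this
              have h2 : 1 ≤ (N : ℝ) * ((g : ℝ) ^ s)⁻¹ := by
                rw [← div_eq_mul_inv, le_div_iff₀ hgs]
                linarith
              push_cast at h1 ⊢
              linarith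
          _ = (Real.log N / Real.log g) * (5 * N) *
              ∑ s ∈ Finset.Icc 1 (Nat.log g N), ((g : ℝ) ^ s)⁻¹ := by
              rw [Finset.mul_sum]
              exact Finset.sum_congr rfl fun s _ => by ring
          _ ≤ (Real.log N / Real.log g) * (5 * N) * (2 / g) := by
              gcongr
              exact sum_inv_pow_le hg2 _
          _ = _ := by
              field_simp
              ring
    _ = 10 * N * Real.log N * ∑ g ∈ Finset.Icc 2 N, ((g : ℝ) * Real.log g)⁻¹ := by
        rw [Finset.mul_sum]
    _ ≤ _ := by
        gcongr
        exact sum_inv_mul_log_le (by omega)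

lemma mem_powerData {N : ℕ} {m p q : ℤ} {g s t : ℕ} (hg : 2 ≤ g) (hs : 1 ≤ s) (ht : 1 ≤ t)
    (hm : m.natAbs = g ^ s) (hq : q.natAbs = g ^ t) (h1 : |q - m * p| ≤ N)
    (h2 : |m * q| ≤ N) : ⟨g, ⟨(s, t), p⟩⟩ ∈ powerData N := by
  have hmpos : 0 < g ^ s := by positivity
  have hqpos : 0 < g ^ t := by positivity
  have h2' : g ^ s * g ^ t ≤ N := by
    rw [Int.abs_eq_natAbs, Int.natAbs_mul, hm, hq] at h2
    exact_mod_cast h2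
  have hsN : g ^ s ≤ N := (Nat.le_mul_of_pos_right _ hqpos).trans h2'
  have htN : g ^ t ≤ N := (Nat.le_mul_of_pos_left _ hmpos).trans h2'
  have hmp : g ^ s * p.natAbs ≤ 2 * N := by
    rw [← hm, ← Int.natAbs_mul]
    rw [← hq] at htN
    rw [abs_le] at h1
    omega
  refine Finset.mem_sigma.2 ⟨Finset.mem_Icc.2 ⟨hg, ?_⟩, Finset.mem_sigma.2 ⟨?_, ?_⟩⟩
  · exact (Nat.le_self_pow (by omega) g).trans hsN
  · exact Finset.mem_product.2 ⟨Finset.mem_Icc.2 ⟨hs, Nat.le_log_of_pow_le (show 1 < g from hg) hsN⟩,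
      Finset.mem_Icc.2 ⟨ht, Nat.le_log_of_pow_le (show 1 < g from hg) htN⟩⟩
  · rw [mem_absBall, Int.abs_eq_natAbs]
    have : p.natAbs ≤ 2 * N / g ^ s := by
      rw [Nat.le_div_iff_mul_le hmpos, mul_comm]
      exact hmp
    exact_mod_cast this

/-- Data `(u, v, t, x, y)` describing triples `(u v t ^ 2, u x, v y)` of product at most `N`. -/
def radicalData (N : ℕ) : Finset ((_ : ℕ × ℕ × ℕ) × (_ : ℕ) × ℕ) :=
  (Finset.Icc 1 N ×ˢ Finset.Icc 1 N ×ˢ Finset.Icc 1 N).sigma fun w =>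
    natHyperbola (N / (w.1 * w.2.1 * w.2.2) ^ 2)

lemma card_radicalData_le (N : ℕ) :
    ((radicalData N).card : ℝ) ≤ 8 * (N * (1 + Real.log N)) := by
  rcases Nat.eq_zero_or_pos N with rfl | hN
  · simp [radicalData]
  have hlogN : 0 ≤ Real.log N := Real.log_natCast_nonneg N
  rw [radicalData, Finset.card_sigma, Nat.cast_sum]
  calc _ ≤ ∑ w ∈ Finset.Icc 1 N ×ˢ Finset.Icc 1 N ×ˢ Finset.Icc 1 N, (N * (1 + Real.log N)) *
        (((w.1 : ℝ) ^ 2)⁻¹ * (((w.2.1 : ℝ) ^ 2)⁻¹ * ((w.2.2 : ℝ) ^ 2)⁻¹)) := by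
        refine Finset.sum_le_sum fun w _ => ?_
        set d := (w.1 * w.2.1 * w.2.2) ^ 2 with hd
        refine (card_natHyperbola_le _).trans ?_
        have h1 : ((N / d : ℕ) : ℝ) ≤ N * (d : ℝ)⁻¹ := by
          rw [← div_eq_mul_inv]
          exact Nat.cast_div_le
        have h2 : Real.log ((N / d : ℕ) : ℝ) ≤ Real.log N := by
          rcases Nat.eq_zero_or_pos (N / d) with h | h
          · rw [h]
            simpa using hlogN
          · refine Real.log_le_log (by exact_mod_cast h) ?_
            exact_mod_cast Nat.div_le_self N d
        have h3 : 0 ≤ Real.log ((N / d : ℕ) : ℝ) := Real.log_natCast_nonneg _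
        calc ((N / d : ℕ) : ℝ) * (1 + Real.log ((N / d : ℕ) : ℝ))
            ≤ (N * (d : ℝ)⁻¹) * (1 + Real.log N) := by gcongr
          _ = _ := by
              rw [hd]
              push_cast
              rw [mul_pow, mul_pow, mul_inv, mul_inv]
              ring
    _ = (N * (1 + Real.log N)) * ((∑ x ∈ Finset.Icc 1 N, ((x : ℝ) ^ 2)⁻¹) *
        ((∑ x ∈ Finset.Icc 1 N, ((x : ℝ) ^ 2)⁻¹) * ∑ x ∈ Finset.Icc 1 N, ((x : ℝ) ^ 2)⁻¹)) := by
        simp only [Finset.sum_product]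
        simp only [← Finset.mul_sum, ← Finset.sum_mul]
    _ ≤ (N * (1 + Real.log N)) * (2 * (2 * 2)) := by
        have := sum_inv_sq_le_two N
        gcongr
    _ = _ := by ring

lemma dvd_of_squarefree_of_prime_dvd {a n : ℕ} (ha : Squarefree a)
    (h : ∀ r : ℕ, r.Prime → r ∣ a → r ∣ n) : a ∣ n := by
  rw [← Nat.prod_primeFactors_of_squarefree ha]
  refine Finset.prod_primes_dvd n (fun r hr => (Nat.prime_of_mem_primeFactors hr).prime)
    fun r hr => h r (Nat.prime_of_mem_primeFactors hr) (Nat.dvd_of_mem_primeFactors hr)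

lemma exists_mem_radicalData {N : ℕ} {m n l : ℤ} (hm : m ≠ 0) (hn : n ≠ 0) (hl : l ≠ 0)
    (hN : |m * n * l| ≤ N) (h : ∀ r : ℕ, r.Prime → (r : ℤ) ∣ m → (r : ℤ) ∣ n * l) :
    ∃ u v t x y : ℕ, ⟨(u, v, t), ⟨x, y⟩⟩ ∈ radicalData N ∧ m.natAbs = u * v * t ^ 2 ∧
      n.natAbs = u * x ∧ l.natAbs = v * y := by
  obtain ⟨a, t, hat, ha⟩ := Nat.sq_mul_squarefree m.natAbs
  have hdvd : a ∣ n.natAbs * l.natAbs := by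
    refine dvd_of_squarefree_of_prime_dvd ha fun r hr hra => ?_
    rw [← Int.natAbs_mul, ← Int.natCast_dvd]
    exact h r hr (Int.natCast_dvd.2 (hat ▸ hra.mul_left _))
  obtain ⟨u, v, ⟨x, hx⟩, ⟨y, hy⟩, rfl⟩ := exists_dvd_and_dvd_of_dvd_mul hdvd
  have hm' : t ^ 2 * (u * v) ≠ 0 := by rw [hat]; simpa using hm
  have hn' : u * x ≠ 0 := by rw [← hx]; simpa using hn
  have hl' : v * y ≠ 0 := by rw [← hy]; simpa using hl
  simp only [ne_eq, mul_eq_zero, pow_eq_zero_iff two_ne_zero, not_or] at hm' hn' hl'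
  obtain ⟨ht, hu, hv⟩ := hm'
  have hprod : (u * v * t) ^ 2 * (x * y) ≤ N := by
    have h1 : m.natAbs * n.natAbs * l.natAbs ≤ N := by
      rw [← Int.natAbs_mul, ← Int.natAbs_mul]
      rw [Int.abs_eq_natAbs] at hN
      exact_mod_cast hN
    rw [← hat, hx, hy] at h1
    calc _ = _ := by ring
      _ ≤ N := h1
  have hxy : 0 < x * y := Nat.pos_of_ne_zero (mul_ne_zero hn'.2 hl'.2)
  have hd : 0 < (u * v * t) ^ 2 := by positivity
  have hle : u * v * t ≤ N :=
    (Nat.le_self_pow two_ne_zero _).trans ((Nat.le_mul_of_pos_right _ hxy).trans hprod)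
  have hu1 : 0 < u := Nat.pos_of_ne_zero hu
  have hv1 : 0 < v := Nat.pos_of_ne_zero hv
  have ht1 : 0 < t := Nat.pos_of_ne_zero ht
  refine ⟨u, v, t, x, y, Finset.mem_sigma.2 ⟨?_, mem_natHyperbola hn'.2 hl'.2 ?_⟩,
    by rw [← hat]; ring, hx, hy⟩
  · simp only [Finset.mem_product, Finset.mem_Icc]
    refine ⟨⟨hu1, ?_⟩, ⟨hv1, ?_⟩, ⟨ht1, ?_⟩⟩
    · exact (Nat.le_mul_of_pos_right u (Nat.mul_pos hv1 ht1)).trans (by rwa [← mul_assoc])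
    · refine le_trans ?_ hle
      calc v ≤ v * (u * t) := Nat.le_mul_of_pos_right v (Nat.mul_pos hu1 ht1)
        _ = u * v * t := by ring
    · refine le_trans ?_ hle
      exact Nat.le_mul_of_pos_left t (Nat.mul_pos hu1 hv1)
  · rw [Nat.le_div_iff_mul_le hd, mul_comm]
    exact hprod

/-- Integer triples with all entries of absolute value at most `N`. -/
noncomputable def box (N : ℕ) : Finset (ℤ × ℤ × ℤ) := absBall N ×ˢ absBall N ×ˢ absBall N

lemma mem_box {N : ℕ} {v : ℤ × ℤ × ℤ} : v ∈ box N ↔ |v.1| ≤ N ∧ |v.2.1| ≤ N ∧ |v.2.2| ≤ N := by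
  simp only [box, Finset.mem_product, mem_absBall]

lemma two_mul_sum_range_sub (K : ℤ) (n : ℕ) :
    2 * ∑ j ∈ Finset.range n, (K - j) = 2 * K * n - n * (n - 1) := by
  induction n with
  | zero => simp
  | succ n ih =>
    rw [Finset.sum_range_succ, mul_add, ih]
    push_cast
    ring

lemma sum_absBall {M : Type*} [AddCommMonoid M] (N : ℕ) (f : ℤ → M) :
    ∑ x ∈ absBall N, f x =
      ∑ j ∈ Finset.range (N + 1), f j + ∑ j ∈ Finset.range N, f (-(j + 1 : ℤ)) := by
  have h : absBall N = (Finset.range (N + 1)).image (fun j : ℕ => (j : ℤ)) ∪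
      (Finset.range N).image (fun j : ℕ => -(j + 1 : ℤ)) := by
    ext x
    simp only [absBall, Finset.mem_Icc, Finset.mem_union, Finset.mem_image, Finset.mem_range]
    constructor
    · intro hx
      rcases le_or_gt 0 x with h | h
      · exact Or.inl ⟨x.toNat, by omega, by omega⟩
      · exact Or.inr ⟨(-x - 1).toNat, by omega, by omega⟩
    · rintro (⟨j, hj, rfl⟩ | ⟨j, hj, rfl⟩) <;> omega
  rw [h, Finset.sum_union, Finset.sum_image, Finset.sum_image]
  · intro x _ y _ hxy
    simp only at hxy
    omega
  · intro x _ y _ hxy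
    simp only at hxy
    omega
  · rw [Finset.disjoint_left]
    simp only [Finset.mem_image, Finset.mem_range]
    rintro x ⟨j, _, rfl⟩ ⟨i, _, hi⟩
    omega

lemma card_filter_root_one (N : ℕ) :
    (((box N).filter fun v => 1 + v.1 + v.2.1 + v.2.2 = 0).card : ℤ) = 3 * N ^ 2 + 3 * N := by
  have h1 : ((box N).filter fun v => 1 + v.1 + v.2.1 + v.2.2 = 0).card =
      ((absBall N).sigma fun a => Finset.Icc (max (-N : ℤ) (-N - 1 - a))
        (min (N : ℤ) (N - 1 - a))).card := by
    refine Finset.card_nbij' (fun v => ⟨v.1, v.2.1⟩) (fun w => (w.1, w.2, -1 - w.1 - w.2))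
      ?_ ?_ ?_ ?_
    · rintro ⟨a, b, c⟩ hv
      simp only [Finset.coe_filter, Set.mem_ofPred_eq, mem_box, abs_le] at hv
      simp only [Finset.coe_sigma, Set.mem_sigma_iff, Finset.mem_coe, mem_absBall, abs_le,
        Finset.mem_Icc]
      omega
    · rintro ⟨a, b⟩ hv
      simp only [Finset.coe_sigma, Set.mem_sigma_iff, Finset.mem_coe, mem_absBall, abs_le,
        Finset.mem_Icc] at hv
      simp only [Finset.coe_filter, Set.mem_ofPred_eq, mem_box, abs_le]
      omega
    · rintro ⟨a, b, c⟩ hv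
      simp only [Finset.coe_filter, Set.mem_ofPred_eq] at hv
      simp only [Prod.mk.injEq, true_and]
      omega
    · rintro ⟨a, b⟩ _
      rfl
  rw [h1, Finset.card_sigma, Nat.cast_sum, sum_absBall]
  have h2 : ∀ j ∈ Finset.range (N + 1), (((Finset.Icc (max (-N : ℤ) (-N - 1 - j))
      (min (N : ℤ) (N - 1 - j))).card : ℕ) : ℤ) = 2 * N - j := by
    intro j hj
    rw [Finset.mem_range] at hj
    rw [Int.card_Icc]
    omega
  have h3 : ∀ j ∈ Finset.range N, (((Finset.Icc (max (-N : ℤ) (-N - 1 - -(j + 1)))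
      (min (N : ℤ) (N - 1 - -(j + 1)))).card : ℕ) : ℤ) = (2 * N + 1) - j := by
    intro j hj
    rw [Finset.mem_range] at hj
    rw [Int.card_Icc]
    omega
  rw [Finset.sum_congr rfl h2, Finset.sum_congr rfl h3]
  have h4 := two_mul_sum_range_sub (2 * N) (N + 1)
  have h5 := two_mul_sum_range_sub (2 * N + 1) N
  push_cast at h4
  linarith

lemma card_filter_root_neg_one (N : ℕ) :
    ((box N).filter fun v => -1 + v.1 - v.2.1 + v.2.2 = 0).card =
      ((box N).filter fun v => 1 + v.1 + v.2.1 + v.2.2 = 0).card := by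
  refine Finset.card_nbij' (fun v => (-v.1, v.2.1, -v.2.2)) (fun v => (-v.1, v.2.1, -v.2.2))
    ?_ ?_ ?_ ?_
  · rintro ⟨a, b, c⟩ hv
    simp only [Finset.coe_filter, Set.mem_ofPred_eq, mem_box, abs_neg] at hv ⊢
    exact ⟨hv.1, by linarith [hv.2]⟩
  · rintro ⟨a, b, c⟩ hv
    simp only [Finset.coe_filter, Set.mem_ofPred_eq, mem_box, abs_neg] at hv ⊢
    exact ⟨hv.1, by linarith [hv.2]⟩
  · rintro ⟨a, b, c⟩ _
    simp
  · rintro ⟨a, b, c⟩ _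
    simp

lemma mem_signs_of_sq_eq_one {c : ℤ} (h : c ^ 2 = 1) : c ∈ signs := by
  simpa [signs] using h

lemma card_filter_const_sq {N : ℕ} (hN : 1 ≤ N) :
    ((box N).filter fun v => v.2.2 ^ 2 = 1).card = (2 * N + 1) ^ 2 * 2 := by
  have : ((box N).filter fun v => v.2.2 ^ 2 = 1) = absBall N ×ˢ absBall N ×ˢ signs := by
    ext ⟨a, b, c⟩
    simp only [Finset.mem_filter, box, Finset.mem_product]
    constructor
    · rintro ⟨⟨ha, hb, _⟩, hc⟩
      exact ⟨ha, hb, mem_signs_of_sq_eq_one hc⟩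
    · rintro ⟨ha, hb, hc⟩
      simp only [signs, Finset.mem_insert, Finset.mem_singleton] at hc
      refine ⟨⟨ha, hb, ?_⟩, ?_⟩
      · rw [mem_absBall]
        rcases hc with rfl | rfl <;> simp <;> omega
      · rcases hc with rfl | rfl <;> rfl
  rw [this, Finset.card_product, Finset.card_product, card_absBall, card_signs]
  ring

/-- Coefficients of the monic cubics with constant term `±1` or with a root `±1`. -/
noncomputable def mainTriples (N : ℕ) : Finset (ℤ × ℤ × ℤ) :=
  (box N).filter fun v => v.2.2 ^ 2 = 1 ∨ 1 + v.1 + v.2.1 + v.2.2 = 0 ∨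
    -1 + v.1 - v.2.1 + v.2.2 = 0

lemma card_mainTriples {N : ℕ} (hN : 1 ≤ N) :
    14 * N ^ 2 ≤ (mainTriples N).card ∧ (mainTriples N).card ≤ 14 * N ^ 2 + 14 * N + 2 := by
  classical
  set S := (box N).filter fun v => v.2.2 ^ 2 = 1 with hS
  set T := (box N).filter fun v => 1 + v.1 + v.2.1 + v.2.2 = 0 with hT
  set U := (box N).filter fun v => -1 + v.1 - v.2.1 + v.2.2 = 0 with hU
  have hmain : mainTriples N = S ∪ (T ∪ U) := by
    rw [mainTriples, Finset.filter_or, Finset.filter_or]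
  have cS : S.card = (2 * N + 1) ^ 2 * 2 := card_filter_const_sq hN
  have cT : T.card = 3 * N ^ 2 + 3 * N := by exact_mod_cast card_filter_root_one N
  have cU : U.card = 3 * N ^ 2 + 3 * N := (card_filter_root_neg_one N).trans cT
  have hcov : (signs ×ˢ absBall N).card = 2 * (2 * N + 1) := by
    rw [Finset.card_product, card_signs, card_absBall]
  have hST : (S ∩ T).card ≤ 2 * (2 * N + 1) := by
    rw [← hcov]
    refine card_le_card_of_cover _ (fun w => (-1 - w.2 - w.1, w.2, w.1)) ?_
    rintro ⟨a, b, c⟩ hv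
    simp only [hS, hT, Finset.mem_inter, Finset.mem_filter, mem_box] at hv
    refine ⟨(c, b), Finset.mem_product.2 ⟨mem_signs_of_sq_eq_one hv.1.2,
      mem_absBall.2 hv.1.1.2.1⟩, ?_⟩
    simp only [Prod.mk.injEq, and_true]
    linarith [hv.2.2]
  have hSU : (S ∩ U).card ≤ 2 * (2 * N + 1) := by
    rw [← hcov]
    refine card_le_card_of_cover _ (fun w => (1 + w.2 - w.1, w.2, w.1)) ?_
    rintro ⟨a, b, c⟩ hv
    simp only [hS, hU, Finset.mem_inter, Finset.mem_filter, mem_box] at hv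
    refine ⟨(c, b), Finset.mem_product.2 ⟨mem_signs_of_sq_eq_one hv.1.2,
      mem_absBall.2 hv.1.1.2.1⟩, ?_⟩
    simp only [Prod.mk.injEq, and_true]
    linarith [hv.2.2]
  have hTU : (T ∩ U).card ≤ 2 * N + 1 := by
    rw [← card_absBall]
    refine card_le_card_of_cover _ (fun c => (-c, -1, c)) ?_
    rintro ⟨a, b, c⟩ hv
    simp only [hT, hU, Finset.mem_inter, Finset.mem_filter, mem_box] at hv
    refine ⟨c, mem_absBall.2 hv.1.1.2.2, ?_⟩
    simp only [Prod.mk.injEq, and_true]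
    constructor <;> linarith [hv.1.2, hv.2.2]
  have e1 := Finset.card_union_add_card_inter S (T ∪ U)
  have e2 := Finset.card_union_add_card_inter T U
  have e3 : (S ∩ (T ∪ U)).card ≤ (S ∩ T).card + (S ∩ U).card := by
    rw [Finset.inter_union_distrib_left]
    exact Finset.card_union_le _ _
  rw [hmain]
  constructor <;> nlinarith

/-- Coefficients of the product of `X - m` and `X ^ 2 + p X + q`. -/
def linearTimesQuadratic (m p q : ℤ) : ℤ × ℤ × ℤ := (p - m, q - m * p, -(m * q))

/-- A family containing the coefficients of all generalized degenerate monic cubics of height at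
most `N` with a vanishing constant coefficient or with at most one nonzero lower coefficient. -/
noncomputable def degenerateTriples (N : ℕ) : Finset (ℤ × ℤ × ℤ) :=
  (absBall N).image (fun c => (0, 0, c)) ∪ ((absBall N).image (fun a => (a, 0, 0)) ∪
  ((absBall N).image (fun b => (0, b, 0)) ∪
  ((absBall N ×ˢ signs).image (fun w => (w.1, w.2, 0)) ∪
  ((absBall N ×ˢ Finset.Icc (1 : ℤ) 4).image (fun w => (w.1, w.1 ^ 2 / w.2, 0)) ∪
  (intHyperbola N).image (fun w => (-(w.1 + w.2), w.1 * w.2, 0))))))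

/-- A family containing the coefficients of the generalized degenerate products of `X - m` and
an irreducible quadratic polynomial. -/
noncomputable def quadraticTriples (N : ℕ) : Finset (ℤ × ℤ × ℤ) :=
  (slopePairs N ×ˢ signs).image (fun w => linearTimesQuadratic w.1.1 w.1.2 w.2) ∪
  ((intHyperbola N).image (fun w => linearTimesQuadratic w.1 0 w.2) ∪
  ((slopePairs N ×ˢ Finset.Icc (1 : ℤ) 4).image
    (fun w => linearTimesQuadratic w.1.1 w.1.2 (w.1.2 ^ 2 / w.2)) ∪
  (powerData N ×ˢ signs ×ˢ signs).image (fun w => linearTimesQuadratic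
    (w.2.1 * (w.1.1 ^ w.1.2.1.1 : ℕ)) w.1.2.2 (w.2.2 * (w.1.1 ^ w.1.2.1.2 : ℕ)))))

/-- Coefficients of the monic cubic with roots `m`, `n`, `l`. -/
def splitTriple (m n l : ℤ) : ℤ × ℤ × ℤ := (-(m + n + l), m * n + n * l + l * m, -(m * n * l))

/-- A family containing the coefficients of the monic cubics with nonzero integer roots, one of
which is only divisible by primes dividing the product of the other two. -/
noncomputable def splitTriples (N : ℕ) : Finset (ℤ × ℤ × ℤ) :=
  (radicalData N ×ˢ signs ×ˢ signs ×ˢ signs).image (fun w => splitTriple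
    (w.2.1 * (w.1.1.1 * w.1.1.2.1 * w.1.1.2.2 ^ 2 : ℕ)) (w.2.2.1 * (w.1.1.1 * w.1.2.1 : ℕ))
    (w.2.2.2 * (w.1.1.2.1 * w.1.2.2 : ℕ)))

lemma eq_sq_ediv {t b a : ℤ} (ht : t ∈ Finset.Icc (1 : ℤ) 4) (h : t * b = a ^ 2) :
    a ^ 2 / t = b := by
  have := (Finset.mem_Icc.1 ht).1
  exact Int.ediv_eq_of_eq_mul_right (by omega) h.symm

lemma card_degenerateTriples_le (N : ℕ) :
    ((degenerateTriples N).card : ℝ) ≤ 9 * (2 * N + 1) + 4 * (N * (1 + Real.log N)) := by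
  have h : (degenerateTriples N).card ≤ 9 * (2 * N + 1) + (intHyperbola N).card := by
    rw [degenerateTriples]
    have h1 : ((absBall N).image (fun c : ℤ => ((0 : ℤ), (0 : ℤ), c))).card ≤ 2 * N + 1 :=
      Finset.card_image_le.trans (card_absBall N).le
    have h2 : ((absBall N).image (fun a : ℤ => (a, (0 : ℤ), (0 : ℤ)))).card ≤ 2 * N + 1 :=
      Finset.card_image_le.trans (card_absBall N).le
    have h3 : ((absBall N).image (fun b : ℤ => ((0 : ℤ), b, (0 : ℤ)))).card ≤ 2 * N + 1 :=
      Finset.card_image_le.trans (card_absBall N).le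
    have h4 : ((absBall N ×ˢ signs).image (fun w => (w.1, w.2, (0 : ℤ)))).card ≤
        (2 * N + 1) * 2 :=
      Finset.card_image_le.trans (by rw [Finset.card_product, card_absBall, card_signs])
    have h5 : ((absBall N ×ˢ Finset.Icc (1 : ℤ) 4).image
        (fun w => (w.1, w.1 ^ 2 / w.2, (0 : ℤ)))).card ≤ (2 * N + 1) * 4 :=
      Finset.card_image_le.trans (by rw [Finset.card_product, card_absBall]; rfl)
    have h6 : ((intHyperbola N).image (fun w => (-(w.1 + w.2), w.1 * w.2, (0 : ℤ)))).card ≤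
        (intHyperbola N).card := Finset.card_image_le
    refine (Finset.card_union_le _ _).trans ?_
    refine (add_le_add h1 ((Finset.card_union_le _ _).trans (add_le_add h2
      ((Finset.card_union_le _ _).trans (add_le_add h3 ((Finset.card_union_le _ _).trans
      (add_le_add h4 ((Finset.card_union_le _ _).trans (add_le_add h5 h6))))))))).trans ?_
    omega
  have h' : ((degenerateTriples N).card : ℝ) ≤ 9 * (2 * N + 1) + (intHyperbola N).card := by
    exact_mod_cast h
  linarith [card_intHyperbola_le N]

lemma card_quadraticTriples_le {N : ℕ} (hN : 3 ≤ N) :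
    ((quadraticTriples N).card : ℝ) ≤ 124 * (N * (1 + Real.log N)) +
      40 * (N * Real.log N *
        ((2 * Real.log 2)⁻¹ + Real.log (Real.log N) - Real.log (Real.log 2))) := by
  have h : (quadraticTriples N).card ≤ (slopePairs N).card * 6 + (intHyperbola N).card +
      (powerData N).card * 4 := by
    rw [quadraticTriples]
    refine (Finset.card_union_le _ _).trans ((add_le_add Finset.card_image_le
      ((Finset.card_union_le _ _).trans (add_le_add Finset.card_image_le
      ((Finset.card_union_le _ _).trans (add_le_add Finset.card_image_le
      Finset.card_image_le))))).trans ?_)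
    have : (Finset.Icc (1 : ℤ) 4).card = 4 := rfl
    simp only [Finset.card_product, card_signs, this]
    omega
  have h' : ((quadraticTriples N).card : ℝ) ≤ (slopePairs N).card * 6 + (intHyperbola N).card +
      (powerData N).card * 4 := by
    exact_mod_cast h
  have h1 := card_slopePairs_le hN
  have h2 := card_intHyperbola_le N
  have h3 := card_powerData_le hN
  linarith

lemma card_splitTriples_le (N : ℕ) :
    ((splitTriples N).card : ℝ) ≤ 64 * (N * (1 + Real.log N)) := by
  have h : (splitTriples N).card ≤ (radicalData N).card * 8 := by
    rw [splitTriples]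
    refine Finset.card_image_le.trans ?_
    simp only [Finset.card_product, card_signs]
    omega
  have h' : ((splitTriples N).card : ℝ) ≤ (radicalData N).card * 8 := by
    exact_mod_cast h
  linarith [card_radicalData_le N]

lemma linearTimesQuadratic_mem_quadraticTriples {N : ℕ} {m p q : ℤ} (hm : m ≠ 0) (hq : q ≠ 0)
    (h1 : |q - m * p| ≤ N) (h2 : |m * q| ≤ N)
    (h : q ^ 2 = 1 ∨ p = 0 ∨ (∃ t ∈ Finset.Icc (1 : ℤ) 4, t * q = p ^ 2) ∨
      ∃ g s t : ℕ, 2 ≤ g ∧ 1 ≤ s ∧ 1 ≤ t ∧ m.natAbs = g ^ s ∧ q.natAbs = g ^ t) :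
    linearTimesQuadratic m p q ∈ quadraticTriples N := by
  have hslope := mem_slopePairs hm hq h1 h2
  simp only [quadraticTriples, Finset.mem_union, Finset.mem_image]
  rcases h with h | rfl | ⟨t, ht, h⟩ | ⟨g, s, t, hg, hs, ht, hmg, hqg⟩
  · exact Or.inl ⟨((m, p), q), Finset.mem_product.2 ⟨hslope, mem_signs_of_sq_eq_one h⟩, rfl⟩
  · exact Or.inr (Or.inl ⟨(m, q), mem_intHyperbola hm hq h2, rfl⟩)
  · refine Or.inr (Or.inr (Or.inl ⟨((m, p), t), Finset.mem_product.2 ⟨hslope, ht⟩, ?_⟩))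
    simp only [eq_sq_ediv ht h]
  · obtain ⟨ε, hε, em⟩ := exists_sign_mul_natAbs m
    obtain ⟨δ, hδ, eq⟩ := exists_sign_mul_natAbs q
    refine Or.inr (Or.inr (Or.inr ⟨(⟨g, ⟨(s, t), p⟩⟩, ε, δ), Finset.mem_product.2
      ⟨mem_powerData hg hs ht hmg hqg h1 h2, Finset.mem_product.2 ⟨hε, hδ⟩⟩, ?_⟩))
    simp only [← hmg, ← hqg, em, eq]

lemma splitTriple_mem_splitTriples {N : ℕ} {m n l : ℤ} (hm : m ≠ 0) (hn : n ≠ 0) (hl : l ≠ 0)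
    (hN : |m * n * l| ≤ N) (h : ∀ r : ℕ, r.Prime → (r : ℤ) ∣ m → (r : ℤ) ∣ n * l) :
    splitTriple m n l ∈ splitTriples N := by
  obtain ⟨u, v, t, x, y, hmem, em, en, el⟩ := exists_mem_radicalData hm hn hl hN h
  obtain ⟨ε, hε, em'⟩ := exists_sign_mul_natAbs m
  obtain ⟨δ, hδ, en'⟩ := exists_sign_mul_natAbs n
  obtain ⟨γ, hγ, el'⟩ := exists_sign_mul_natAbs l
  refine Finset.mem_image.2 ⟨(⟨(u, v, t), ⟨x, y⟩⟩, ε, δ, γ), ?_, ?_⟩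
  · simp only [Finset.mem_product]
    exact ⟨hmem, hε, hδ, hγ⟩
  · simp only [← em, ← en, ← el, em', en', el']

lemma mem_exceptional {N : ℕ} {a b c : ℤ} (hbox : (a, b, c) ∈ box N)
    (hdeg : GenDeg (monicCubic a b c)) (hmain : (a, b, c) ∉ mainTriples N) :
    (a, b, c) ∈ degenerateTriples N ∪ (quadraticTriples N ∪ splitTriples N) := by
  have hmain' : ¬ (c ^ 2 = 1 ∨ 1 + a + b + c = 0 ∨ -1 + a - b + c = 0) := fun h =>
    hmain (Finset.mem_filter.2 ⟨hbox, h⟩)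
  simp only [not_or] at hmain'
  obtain ⟨ha, hb, hc⟩ := mem_box.1 hbox
  simp only at ha hb hc
  have ha' := mem_absBall.2 ha
  have hb' := mem_absBall.2 hb
  have hc' := mem_absBall.2 hc
  simp only [Finset.mem_union]
  rcases genDeg_classification hdeg hmain'.1 hmain'.2.1 hmain'.2.2 with
    ⟨rfl, rfl⟩ | ⟨rfl, rfl⟩ | ⟨rfl, n, l, hn, hl, rfl, rfl⟩ | ⟨rfl, rfl | h | ⟨t, ht, h⟩⟩ |
    ⟨m, p, q, hm, hq, rfl, rfl, rfl, h⟩ | ⟨m, n, l, hm, hn, hl, rfl, rfl, rfl, h⟩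
  · left
    simp only [degenerateTriples, Finset.mem_union, Finset.mem_image]
    exact Or.inl ⟨c, hc', rfl⟩
  · left
    simp only [degenerateTriples, Finset.mem_union, Finset.mem_image]
    exact Or.inr (Or.inl ⟨a, ha', rfl⟩)
  · left
    simp only [degenerateTriples, Finset.mem_union, Finset.mem_image]
    exact Or.inr (Or.inr (Or.inr (Or.inr (Or.inr ⟨(n, l), mem_intHyperbola hn hl hb, rfl⟩))))
  · left
    simp only [degenerateTriples, Finset.mem_union, Finset.mem_image]
    exact Or.inr (Or.inr (Or.inl ⟨b, hb', rfl⟩))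
  · left
    simp only [degenerateTriples, Finset.mem_union, Finset.mem_image]
    exact Or.inr (Or.inr (Or.inr (Or.inl ⟨(a, b), Finset.mem_product.2
      ⟨ha', mem_signs_of_sq_eq_one h⟩, rfl⟩)))
  · left
    simp only [degenerateTriples, Finset.mem_union, Finset.mem_image]
    refine Or.inr (Or.inr (Or.inr (Or.inr (Or.inl ⟨(a, t), Finset.mem_product.2 ⟨ha', ht⟩, ?_⟩))))
    simp only [eq_sq_ediv ht h]
  · rw [abs_neg] at hc
    exact Or.inr (Or.inl (linearTimesQuadratic_mem_quadraticTriples hm hq hb hc h))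
  · rw [abs_neg] at hc
    exact Or.inr (Or.inr (splitTriple_mem_splitTriples hm hn hl hc h))

lemma genDeg_of_mem_mainTriples {N : ℕ} {v : ℤ × ℤ × ℤ} (h : v ∈ mainTriples N) :
    GenDeg (monicCubic v.1 v.2.1 v.2.2) := by
  rcases (Finset.mem_filter.1 h).2 with h | h | h
  · exact genDeg_of_const_sq_eq_one h
  · exact genDeg_of_root_one h
  · exact genDeg_of_root_neg_one h

open Classical in
lemma ncard_Mset_three {N : ℕ} (hN : 1 ≤ N) : (Mset 3 N).ncard =
    ((box N).filter fun v => GenDeg (monicCubic v.1 v.2.1 v.2.2)).card := by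
  have h : Mset 3 N = (fun v : ℤ × ℤ × ℤ => monicCubic v.1 v.2.1 v.2.2) ''
      ((box N).filter fun v => GenDeg (monicCubic v.1 v.2.1 v.2.2) : Finset (ℤ × ℤ × ℤ)) := by
    have hN' : (1 : ℤ) ≤ N := by exact_mod_cast hN
    ext f
    simp only [Mset, Set.mem_ofPred_eq, Set.mem_image, Finset.mem_coe, Finset.mem_filter, mem_box]
    constructor
    · rintro ⟨hf, hd, hh, hg⟩
      have e := eq_monicCubic hf hd
      refine ⟨(f.coeff 2, f.coeff 1, f.coeff 0), ⟨⟨hh 2, hh 1, hh 0⟩, ?_⟩, e.symm⟩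
      rwa [e] at hg
    · rintro ⟨v, ⟨hv, hg⟩, rfl⟩
      exact ⟨monicCubic_monic _ _ _, monicCubic_natDegree _ _ _,
        (heightLe_monicCubic_iff hN').2 hv, hg⟩
  rw [h, Set.InjOn.ncard_image, Set.ncard_coe_finset]
  rintro ⟨a, b, c⟩ _ ⟨a', b', c'⟩ _ he
  simp only at he
  have h2 := congrArg (fun f => f.coeff 2) he
  have h1 := congrArg (fun f => f.coeff 1) he
  have h0 := congrArg (fun f => f.coeff 0) he
  simp only [monicCubic_coeff_two, monicCubic_coeff_one, monicCubic_coeff_zero] at h2 h1 h0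
  rw [h2, h1, h0]

lemma ncard_Mset_three_bounds {N : ℕ} (hN : 1 ≤ N) :
    14 * N ^ 2 ≤ (Mset 3 N).ncard ∧ (Mset 3 N).ncard ≤ 14 * N ^ 2 + 14 * N + 2 +
      ((degenerateTriples N).card + ((quadraticTriples N).card + (splitTriples N).card)) := by
  classical
  obtain ⟨h1, h2⟩ := card_mainTriples hN
  rw [ncard_Mset_three hN]
  constructor
  · refine h1.trans (Finset.card_le_card fun v hv => Finset.mem_filter.2
      ⟨(Finset.mem_filter.1 hv).1, genDeg_of_mem_mainTriples hv⟩)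
  · have hsub : ((box N).filter fun v => GenDeg (monicCubic v.1 v.2.1 v.2.2)) ⊆
        mainTriples N ∪ (degenerateTriples N ∪ (quadraticTriples N ∪ splitTriples N)) := by
      rintro ⟨a, b, c⟩ hv
      obtain ⟨hbox, hdeg⟩ := Finset.mem_filter.1 hv
      by_cases hmain : (a, b, c) ∈ mainTriples N
      · exact Finset.mem_union_left _ hmain
      · exact Finset.mem_union_right _ (mem_exceptional hbox hdeg hmain)
    refine (Finset.card_le_card hsub).trans ((Finset.card_union_le _ _).trans
      (add_le_add h2 ((Finset.card_union_le _ _).trans (add_le_add le_rfl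
      (Finset.card_union_le _ _)))))

theorem stmt_7 :
    ∃ C : ℝ, 0 < C ∧ ∀ H : ℤ, 3 ≤ H →
      |((Mset 3 H).ncard : ℝ) - 14 * (H : ℝ) ^ 2| ≤
        C * (H : ℝ) * Real.log H * Real.log (Real.log H) := by
  have hlog3 : 1 < Real.log 3 := by
    rw [Real.lt_log_iff_exp_lt (by norm_num)]
    linarith [Real.exp_one_lt_d9]
  set δ := Real.log (Real.log 3) with hδ
  have hδ0 : 0 < δ := Real.log_pos hlog3
  set K := (2 * Real.log 2)⁻¹ - Real.log (Real.log 2) with hK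
  have hK0 : 0 ≤ K := by
    have h2 : Real.log 2 < 1 := by linarith [Real.log_two_lt_d9]
    have h2' : 0 < Real.log 2 := Real.log_pos (by norm_num)
    have := Real.log_neg h2' h2
    have : 0 < (2 * Real.log 2)⁻¹ := by positivity
    linarith
  refine ⟨(500 + 40 * K) * δ⁻¹ + 40, by positivity, fun H hH => ?_⟩
  lift H to ℕ using (by omega) with N
  have hN : 3 ≤ N := by exact_mod_cast hH
  obtain ⟨h1, h2⟩ := ncard_Mset_three_bounds (N := N) (by omega)
  have h1' : 14 * (N : ℝ) ^ 2 ≤ (Mset 3 N).ncard := by exact_mod_cast h1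
  have h2' : ((Mset 3 N).ncard : ℝ) ≤ 14 * (N : ℝ) ^ 2 + 14 * N + 2 +
      ((degenerateTriples N).card + ((quadraticTriples N).card + (splitTriples N).card)) := by
    exact_mod_cast h2
  have b1 := card_degenerateTriples_le N
  have b2 := card_quadraticTriples_le hN
  have b3 := card_splitTriples_le N
  have hN' : (3 : ℝ) ≤ N := by exact_mod_cast hN
  have hL : Real.log 3 ≤ Real.log N := Real.log_le_log (by norm_num) hN'
  have hLL : δ ≤ Real.log (Real.log N) := Real.log_le_log (by linarith) hL
  rw [Int.cast_natCast, abs_of_nonneg (by linarith)]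
  set L := Real.log N with hLdef
  set l := Real.log L with hldef
  have hNL : (N : ℝ) ≤ N * L := le_mul_of_one_le_right (by linarith) (by linarith)
  have hNL0 : 0 ≤ (N : ℝ) * L := by linarith
  have hfin : (500 + 40 * K) * (N * L) ≤ (500 + 40 * K) * (N * L) * (δ⁻¹ * l) := by
    refine le_mul_of_one_le_right (by positivity) ?_
    rw [inv_mul_eq_div, le_div_iff₀ hδ0, one_mul]
    exact hLL
  have hb : N * L * ((2 * Real.log 2)⁻¹ + l - Real.log (Real.log 2)) =
      K * (N * L) + N * L * l := by
    rw [hK]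
    ring
  rw [hb] at b2
  calc _ ≤ (500 + 40 * K) * (N * L) + 40 * (N * L * l) := by nlinarith
    _ ≤ (500 + 40 * K) * (N * L) * (δ⁻¹ * l) + 40 * (N * L * l) := by linarith
    _ = _ := by ring
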